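/- arXiv:1904.06464 — 4 statements merged into one kernel-verified Lean document; each statement's English description precedes it below -/
import Mathlib

section
/- Let (M⁻,M⁺) be a bipartite symbolic matrix bisystem over a common alphabet Σ = C ⊔ D with bipartite data P_{l,l+1}, Q_{l,l+1}, X_{l,l+1}, Y_{l,l+1}, and write P_l = P_{l,l+1}, Q_l = Q_{l,l+1}, X_l = X_{l,l+1}, Y_l = Y_{l,l+1}. Define M^{CD+}_{l,l+1} = P_{2l}Q_{2l+1}, M^{DC+}_{l,l+1} = Q_{2l}P_{2l+1}, and M^{CD-}_{l,l+1}, M^{DC-}_{l,l+1} to be the entrywise images under the exchanging specification κ of X_{2l}Y_{2l+1} and Y_{2l}X_{2l+1}, respectively. Then (M^{CD-}, M^{CD+}) is a symbolic matrix bisystem over the alphabet C·D and (M^{DC-}, M^{DC+}) is one over D·C, and they are properly strong shift equivalent in 1-step, witnessed by the matrices P_l, Q_l, X_l, Y_l (in particular Y_l P_{l+1} ≃_κ P_l Y_{l+1} and X_l Q_{l+1} ≃_κ Q_l X_{l+1} for l odd, and X_l P_{l+1} ≃_κ P_l X_{l+1} and Y_l Q_{l+1} ≃_κ Q_l Y_{l+1}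 for l even). -/
/-- Product of two symbolic matrices: the entries of the product of a symbolic matrix
over `C` and a symbolic matrix over `D` are formal sums (multisets) of two-letter
words in `C·D`. -/
def symMul {I J K C D : Type} [Fintype J]
    (A : I → J → Multiset C) (B : J → K → Multiset D) : I → K → Multiset (C × D) :=
  fun i k => ∑ j : J, (A i j).bind fun a => (B j k).map fun b => (a, b)
/-- The underlying data of a symbolic matrix bisystem: sequences of `m l × m (l+1)`
symbolic matrices (entries are formal sums, i.e. multisets, of symbols). -/
structure SMBData (Sm Sp : Type) where
  m : ℕ → ℕ
  Mm : ∀ l, Fin (m l) → Fin (m (l + 1)) → Multiset Sm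
  Mp : ∀ l, Fin (m l) → Fin (m (l + 1)) → Multiset Sp

/-- The axioms making the data `M` a symbolic matrix bisystem: nonzero rows and
columns, no repeated symbol in an entry, no symbol repeated across the rows of a
column (right/left resolving), and the κ-commutation relation
`M⁻_{l,l+1} M⁺_{l+1,l+2} ≃_κ M⁺_{l,l+1} M⁻_{l+1,l+2}`. -/
structure IsSMB {Sm Sp : Type} (M : SMBData Sm Sp) : Prop where
  mpos : ∀ l, 0 < M.m l
  row_m : ∀ l i, ∃ j, M.Mm l i j ≠ 0
  col_m : ∀ l j, ∃ i, M.Mm l i j ≠ 0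
  row_p : ∀ l i, ∃ j, M.Mp l i j ≠ 0
  col_p : ∀ l j, ∃ i, M.Mp l i j ≠ 0
  nodup_m : ∀ l i j, (M.Mm l i j).Nodup
  nodup_p : ∀ l i j, (M.Mp l i j).Nodup
  res_m : ∀ l j i i' a, a ∈ M.Mm l i j → a ∈ M.Mm l i' j → i = i'
  res_p : ∀ l j i i' a, a ∈ M.Mp l i j → a ∈ M.Mp l i' j → i = i'
  commute : ∀ l i j,
    (symMul (M.Mm l) (M.Mp (l + 1)) i j).map Prod.swap = symMul (M.Mp l) (M.Mm (l + 1)) i j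

/-- Entries of the product of `k` consecutive symbolic matrices starting at level `n`:
formal sums of words of length `k`. -/
def prodFrom {S : Type} {m : ℕ → ℕ}
    (M : ∀ l, Fin (m l) → Fin (m (l + 1)) → Multiset S) (n : ℕ) :
    (k : ℕ) → Fin (m n) → Fin (m (n + k)) → Multiset (List S)
  | 0, i, j => if i = j then {[]} else 0
  | k + 1, i, j =>
      ∑ p : Fin (m (n + k)),
        (prodFrom M n k i p).bind fun w => (M (n + k) p j).map fun a => w ++ [a]

/-- FPCC for a symbolic matrix bisystem over a common alphabet: it is standard
(`m 0 = 1`) and for every `l ≥ 1` the words appearing in the `(1,j)` entry of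
`M⁻_{0,1}⋯M⁻_{l-1,l}` are exactly the reversed words appearing in the `(1,j)` entry
of `M⁺_{0,1}⋯M⁺_{l-1,l}`. -/
def SMBData.FPCC {S : Type} (M : SMBData S S) : Prop :=
  M.m 0 = 1 ∧
  ∀ l : ℕ, 1 ≤ l → ∀ (i : Fin (M.m 0)) (j : Fin (M.m (0 + l))) (w : List S),
    w ∈ prodFrom M.Mm 0 l i j ↔ w.reverse ∈ prodFrom M.Mp 0 l i j

/-- The set of nonempty admissible words of the presenting subshift of a symbolic
matrix bisystem: the words appearing as entries of products
`M⁺_{l,l+1} M⁺_{l+1,l+2} ⋯ M⁺_{l+k-1,l+k}`. -/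
def smbWords {S : Type} (M : SMBData S S) : Set (List S) :=
  { w | w ≠ [] ∧ ∃ (n k : ℕ) (i : Fin (M.m n)) (j : Fin (M.m (n + k))),
      w ∈ prodFrom M.Mp n k i j }
/-- The data of a properly strong shift equivalence in 1-step between two symbolic
matrix bisystems `M` (over `Σ_M`) and `N` (over `Σ_N`), with alphabets `C, D`,
specifications `φ : Σ_M → C·D`, `ψ : Σ_N → D·C`, and matrices `P_l` over `C`, `Q_l`
over `D`, `X_l` over `D` and `Y_l` over `C` (the parity-dependent families `X, Y`
are recorded as `Xe l = X_{2l}`, `Xo l = X_{2l+1}`, `Ye l = Y_{2l}`, `Yo l = Y_{2l+1}`),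
subject to the defining specified equivalences. -/
structure PSSE1Data (C D : Type) {SM SN : Type} (M : SMBData SM SM) (N : SMBData SN SN) where
  φ : SM → C × D
  ψ : SN → D × C
  φ_inj : Function.Injective φ
  ψ_inj : Function.Injective ψ
  c : ℕ → ℕ
  d : ℕ → ℕ
  hc : ∀ l, c (2 * l) = M.m l
  hd : ∀ l, d (2 * l) = N.m l
  P : ∀ l, Fin (c l) → Fin (d (l + 1)) → Multiset C
  Q : ∀ l, Fin (d l) → Fin (c (l + 1)) → Multiset D
  Xe : ∀ l, Fin (c (2 * l)) → Fin (c (2 * l + 1)) → Multiset D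
  Xo : ∀ l, Fin (d (2 * l + 1)) → Fin (d (2 * l + 2)) → Multiset D
  Ye : ∀ l, Fin (d (2 * l)) → Fin (d (2 * l + 1)) → Multiset C
  Yo : ∀ l, Fin (c (2 * l + 1)) → Fin (c (2 * l + 2)) → Multiset C
  hMp : ∀ l i j, (M.Mp l i j).map φ =
    symMul (P (2 * l)) (Q (2 * l + 1)) (Fin.cast (hc l).symm i) (Fin.cast (hc (l + 1)).symm j)
  hNp : ∀ l i j, (N.Mp l i j).map ψ =
    symMul (Q (2 * l)) (P (2 * l + 1)) (Fin.cast (hd l).symm i) (Fin.cast (hd (l + 1)).symm j)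
  hMm : ∀ l i j, (M.Mm l i j).map (Prod.swap ∘ φ) =
    symMul (Xe l) (Yo l) (Fin.cast (hc l).symm i) (Fin.cast (hc (l + 1)).symm j)
  hNm : ∀ l i j, (N.Mm l i j).map (Prod.swap ∘ ψ) =
    symMul (Ye l) (Xo l) (Fin.cast (hd l).symm i) (Fin.cast (hd (l + 1)).symm j)
  hYP : ∀ l i j, (symMul (Yo l) (P (2 * l + 2)) i j).map Prod.swap =
    symMul (P (2 * l + 1)) (Ye (l + 1)) i j
  hXQ : ∀ l i j, (symMul (Xo l) (Q (2 * l + 2)) i j).map Prod.swap =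
    symMul (Q (2 * l + 1)) (Xe (l + 1)) i j
  hXP : ∀ l i j, (symMul (Xe l) (P (2 * l + 1)) i j).map Prod.swap =
    symMul (P (2 * l)) (Xo l) i j
  hYQ : ∀ l i j, (symMul (Ye l) (Q (2 * l + 1)) i j).map Prod.swap =
    symMul (Q (2 * l)) (Yo l) i j

/-- Properly strong shift equivalence in 1-step. -/
def PSSE1 {SM SN : Type} (M : SMBData SM SM) (N : SMBData SN SN) : Prop :=
  ∃ C D : Type, Nonempty (PSSE1Data C D M N)

/-- The bipartite data `P_{l,l+1}, Q_{l,l+1}, X_{l,l+1}, Y_{l,l+1}` of a bipartite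
symbolic matrix bisystem over `Σ = C ⊔ D`; the parity-dependent families `X, Y` are
recorded as `Xe l = X_{2l,2l+1}`, `Xo l = X_{2l+1,2l+2}`, `Ye l = Y_{2l,2l+1}`,
`Yo l = Y_{2l+1,2l+2}`. -/
structure BipartiteSMBData (C D : Type) where
  c : ℕ → ℕ
  d : ℕ → ℕ
  P : ∀ l, Fin (c l) → Fin (d (l + 1)) → Multiset C
  Q : ∀ l, Fin (d l) → Fin (c (l + 1)) → Multiset D
  Xe : ∀ l, Fin (c (2 * l)) → Fin (c (2 * l + 1)) → Multiset D
  Xo : ∀ l, Fin (d (2 * l + 1)) → Fin (d (2 * l + 2)) → Multiset D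
  Ye : ∀ l, Fin (d (2 * l)) → Fin (d (2 * l + 1)) → Multiset C
  Yo : ∀ l, Fin (c (2 * l + 1)) → Fin (c (2 * l + 2)) → Multiset C

/-- Decompose an index of `Fin m`, `m = a + b`, into the corresponding block index. -/
def splitIdx {m a b : ℕ} (h : m = a + b) (i : Fin m) : Fin a ⊕ Fin b :=
  finSumFinEquiv.symm (Fin.cast h i)

/-- The block matrix `[[0, P],[Q, 0]]` prescribing `M⁺_{l,l+1}`. -/
def blockPlus {C D : Type} (B : BipartiteSMBData C D) (l : ℕ) :
    Fin (B.c l) ⊕ Fin (B.d l) → Fin (B.c (l + 1)) ⊕ Fin (B.d (l + 1)) → Multiset (C ⊕ D)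
  | Sum.inl i, Sum.inr j => (B.P l i j).map Sum.inl
  | Sum.inr i, Sum.inl j => (B.Q l i j).map Sum.inr
  | _, _ => 0

/-- The block matrix `[[X, 0],[0, Y]]` prescribing `M⁻_{l,l+1}` for `l` even. -/
def blockMinusE {C D : Type} (B : BipartiteSMBData C D) (k : ℕ) :
    Fin (B.c (2 * k)) ⊕ Fin (B.d (2 * k)) →
      Fin (B.c (2 * k + 1)) ⊕ Fin (B.d (2 * k + 1)) → Multiset (C ⊕ D)
  | Sum.inl i, Sum.inl j => (B.Xe k i j).map Sum.inr
  | Sum.inr i, Sum.inr j => (B.Ye k i j).map Sum.inl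
  | _, _ => 0

/-- The block matrix `[[Y, 0],[0, X]]` prescribing `M⁻_{l,l+1}` for `l` odd. -/
def blockMinusO {C D : Type} (B : BipartiteSMBData C D) (k : ℕ) :
    Fin (B.c (2 * k + 1)) ⊕ Fin (B.d (2 * k + 1)) →
      Fin (B.c (2 * k + 2)) ⊕ Fin (B.d (2 * k + 2)) → Multiset (C ⊕ D)
  | Sum.inl i, Sum.inl j => (B.Yo k i j).map Sum.inl
  | Sum.inr i, Sum.inr j => (B.Xo k i j).map Sum.inr
  | _, _ => 0

/-- `M` is a bipartite symbolic matrix bisystem with bipartite data `B`. -/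
def IsBipartiteWith {C D : Type} (M : SMBData (C ⊕ D) (C ⊕ D)) (B : BipartiteSMBData C D)
    (hm : ∀ l, M.m l = B.c l + B.d l) : Prop :=
  (∀ l i j, M.Mp l i j = blockPlus B l (splitIdx (hm l) i) (splitIdx (hm (l + 1)) j)) ∧
  (∀ k i j, M.Mm (2 * k) i j =
      blockMinusE B k (splitIdx (hm (2 * k)) i) (splitIdx (hm (2 * k + 1)) j)) ∧
  (∀ k i j, M.Mm (2 * k + 1) i j =
      blockMinusO B k (splitIdx (hm (2 * k + 1)) i) (splitIdx (hm (2 * k + 2)) j))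

/-- `M^{CD} = (M^{CD-}, M^{CD+})` over the alphabet `C·D`:
`M^{CD+}_{l,l+1} = P_{2l}Q_{2l+1}` and `M^{CD-}_{l,l+1} = κ(X_{2l}Y_{2l+1})`. -/
def MCD {C D : Type} (B : BipartiteSMBData C D) : SMBData (C × D) (C × D) where
  m := fun l => B.c (2 * l)
  Mp := fun l => symMul (B.P (2 * l)) (B.Q (2 * l + 1))
  Mm := fun l i j => (symMul (B.Xe l) (B.Yo l) i j).map Prod.swap

/-- `M^{DC} = (M^{DC-}, M^{DC+})` over the alphabet `D·C`:
`M^{DC+}_{l,l+1} = Q_{2l}P_{2l+1}` and `M^{DC-}_{l,l+1} = κ(Y_{2l}X_{2l+1})`. -/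
def MDC {C D : Type} (B : BipartiteSMBData C D) : SMBData (D × C) (D × C) where
  m := fun l => B.d (2 * l)
  Mp := fun l => symMul (B.Q (2 * l)) (B.P (2 * l + 1))
  Mm := fun l i j => (symMul (B.Ye l) (B.Xo l) i j).map Prod.swap

/-- A symbolic matrix without zero rows or zero columns, without repeated symbols in an
entry, and in which no symbol occurs in two different rows of a column. -/
structure IsResolving {I J S : Type} (A : I → J → Multiset S) : Prop where
  row : ∀ i, ∃ j, A i j ≠ 0
  col : ∀ j, ∃ i, A i j ≠ 0
  nodup : ∀ i j, (A i j).Nodup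
  res : ∀ j i i' a, a ∈ A i j → a ∈ A i' j → i = i'

/-- The relation `AB ≃_κ EF` between products of symbolic matrices, on the level of the
sets of words occurring in the entries. -/
def KappaRel {I J J' K S T : Type} (A : I → J → Multiset S) (B : J → K → Multiset T)
    (E : I → J' → Multiset T) (F : J' → K → Multiset S) : Prop :=
  ∀ i k a b, (∃ j, a ∈ A i j ∧ b ∈ B j k) ↔ ∃ j, b ∈ E i j ∧ a ∈ F j k

theorem mem_symMul {I J K S T : Type} [Fintype J] {A : I → J → Multiset S}
    {B : J → K → Multiset T} {i : I} {k : K} {x : S × T} :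
    x ∈ symMul A B i k ↔ ∃ j, x.1 ∈ A i j ∧ x.2 ∈ B j k := by
  obtain ⟨a, b⟩ := x
  simp only [symMul, Multiset.mem_sum, Finset.mem_univ, true_and, Multiset.mem_bind,
    Multiset.mem_map, Prod.mk.injEq]
  grind

theorem mem_map_swap_symMul {I J K S T : Type} [Fintype J] {A : I → J → Multiset S}
    {B : J → K → Multiset T} {i : I} {k : K} {x : T × S} :
    x ∈ (symMul A B i k).map Prod.swap ↔ ∃ j, x.2 ∈ A i j ∧ x.1 ∈ B j k := by
  have h := Multiset.mem_map_of_injective Prod.swap_injective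
    (s := symMul A B i k) (a := x.swap)
  rwa [Prod.swap_swap, mem_symMul] at h

theorem symMul_ne_zero {I J K S T : Type} [Fintype J] {A : I → J → Multiset S}
    {B : J → K → Multiset T} {i : I} {j : J} {k : K} (hA : A i j ≠ 0) (hB : B j k ≠ 0) :
    symMul A B i k ≠ 0 := by
  obtain ⟨a, ha⟩ := Multiset.exists_mem_of_ne_zero hA
  obtain ⟨b, hb⟩ := Multiset.exists_mem_of_ne_zero hB
  intro h
  have : (a, b) ∈ symMul A B i k := mem_symMul.2 ⟨j, ha, hb⟩
  simp [h] at this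

namespace IsResolving

theorem symMul {I J K S T : Type} [Fintype J] {A : I → J → Multiset S}
    {B : J → K → Multiset T} (hA : IsResolving A) (hB : IsResolving B) :
    IsResolving (symMul A B) where
  row i := by
    obtain ⟨j, hj⟩ := hA.row i
    obtain ⟨k, hk⟩ := hB.row j
    exact ⟨k, symMul_ne_zero hj hk⟩
  col k := by
    obtain ⟨j, hj⟩ := hB.col k
    obtain ⟨i, hi⟩ := hA.col j
    exact ⟨i, symMul_ne_zero hi hj⟩
  nodup i k := by
    have h : _root_.symMul A B i k =
        (Finset.univ : Finset J).val.bind fun j => A i j ×ˢ B j k := rfl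
    rw [h, Multiset.nodup_bind]
    refine ⟨fun j _ => (hA.nodup i j).product (hB.nodup j k), ?_⟩
    refine Finset.univ.nodup.pairwise fun j _ j' _ hjj' => ?_
    rw [Function.onFun, Multiset.disjoint_left]
    rintro ⟨a, b⟩ h₁ h₂
    rw [Multiset.mem_product] at h₁ h₂
    exact hjj' (hB.res k j j' b h₁.2 h₂.2)
  res k i i' x hx hx' := by
    obtain ⟨j, ha, hb⟩ := mem_symMul.1 hx
    obtain ⟨j', ha', hb'⟩ := mem_symMul.1 hx'
    obtain rfl := hB.res k j j' _ hb hb'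
    exact hA.res j i i' _ ha ha'

theorem map {I J S T : Type} {A : I → J → Multiset S} (hA : IsResolving A) {f : S → T}
    (hf : Function.Injective f) : IsResolving fun i j => (A i j).map f where
  row i := by simpa using hA.row i
  col j := by simpa using hA.col j
  nodup i j := (hA.nodup i j).map hf
  res j i i' x hx hx' := by
    obtain ⟨a, ha, rfl⟩ := Multiset.mem_map.1 hx
    rw [Multiset.mem_map_of_injective hf] at hx'
    exact hA.res j i i' a ha hx'

theorem reindex {I I' J J' S : Type} {A : I → J → Multiset S} (hA : IsResolving A)
    {F : I' → J' → Multiset S} (e : I ≃ I') (f : J ≃ J')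
    (h : ∀ i j, A i j = F (e i) (f j)) : IsResolving F := by
  have hF : ∀ i j, F i j = A (e.symm i) (f.symm j) := fun i j => by simp [h]
  refine ⟨fun i => ?_, fun j => ?_, fun i j => ?_, fun j i i' a ha ha' => ?_⟩
  · obtain ⟨j, hj⟩ := hA.row (e.symm i)
    exact ⟨f j, by simpa [hF] using hj⟩
  · obtain ⟨i, hi⟩ := hA.col (f.symm j)
    exact ⟨e i, by simpa [hF] using hi⟩
  · rw [hF]; exact hA.nodup _ _
  · rw [hF] at ha ha'
    exact e.symm.injective (hA.res _ _ _ a ha ha')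

/-- A block of a resolving matrix that is the only nonzero block in its rows and columns
is resolving. -/
theorem block {I I' J J' S T : Type} {F : I → J → Multiset S} (hF : IsResolving F)
    {A : I' → J' → Multiset T} {u : I' → I} {v : J' → J} {g : T → S}
    (hu : Function.Injective u)
    (h : ∀ i j, F (u i) (v j) = (A i j).map g)
    (hrow : ∀ i j, F (u i) j ≠ 0 → j ∈ Set.range v)
    (hcol : ∀ i j, F i (v j) ≠ 0 → i ∈ Set.range u) : IsResolving A where
  row i := by
    obtain ⟨j, hj⟩ := hF.row (u i)
    obtain ⟨j, rfl⟩ := hrow i j hj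
    exact ⟨j, by simpa [h] using hj⟩
  col j := by
    obtain ⟨i, hi⟩ := hF.col (v j)
    obtain ⟨i, rfl⟩ := hcol i j hi
    exact ⟨i, by simpa [h] using hi⟩
  nodup i j := Multiset.Nodup.of_map g (h i j ▸ hF.nodup (u i) (v j))
  res j i i' a ha ha' := by
    refine hu (hF.res (v j) _ _ (g a) ?_ ?_) <;> rw [h]
    · exact Multiset.mem_map_of_mem g ha
    · exact Multiset.mem_map_of_mem g ha'

end IsResolving

theorem kappaRel_of_map_swap_eq {I J J' K S T : Type} [Fintype J] [Fintype J']
    {A : I → J → Multiset S} {B : J → K → Multiset T}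
    {E : I → J' → Multiset T} {F : J' → K → Multiset S}
    (h : ∀ i k, (symMul A B i k).map Prod.swap = symMul E F i k) : KappaRel A B E F := by
  intro i k a b
  have h₁ := mem_map_swap_symMul (A := A) (B := B) (i := i) (k := k) (x := (b, a))
  rw [h, mem_symMul] at h₁
  exact h₁.symm

theorem KappaRel.map_swap_eq {I J J' K S T : Type} [Fintype J] [Fintype J']
    {A : I → J → Multiset S} {B : J → K → Multiset T}
    {E : I → J' → Multiset T} {F : J' → K → Multiset S} (h : KappaRel A B E F)
    (hA : IsResolving A) (hB : IsResolving B) (hE : IsResolving E) (hF : IsResolving F)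
    (i : I) (k : K) : (symMul A B i k).map Prod.swap = symMul E F i k := by
  refine (Multiset.Nodup.ext (((hA.symMul hB).map Prod.swap_injective).nodup i k)
    ((hE.symMul hF).nodup i k)).2 fun x => ?_
  rw [mem_map_swap_symMul, mem_symMul]
  exact h i k x.2 x.1

theorem KappaRel.reindex {I J J' K I₁ J₁ J₁' K₁ S T : Type}
    {A : I → J → Multiset S} {B : J → K → Multiset T}
    {E : I → J' → Multiset T} {F : J' → K → Multiset S} (h : KappaRel A B E F)
    {A₁ : I₁ → J₁ → Multiset S} {B₁ : J₁ → K₁ → Multiset T}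
    {E₁ : I₁ → J₁' → Multiset T} {F₁ : J₁' → K₁ → Multiset S}
    (e : I ≃ I₁) (f : J ≃ J₁) (f' : J' ≃ J₁') (g : K ≃ K₁)
    (hA : ∀ i j, A i j = A₁ (e i) (f j)) (hB : ∀ j k, B j k = B₁ (f j) (g k))
    (hE : ∀ i j, E i j = E₁ (e i) (f' j)) (hF : ∀ j k, F j k = F₁ (f' j) (g k)) :
    KappaRel A₁ B₁ E₁ F₁ := by
  intro i k a b
  have h₁ := h (e.symm i) (g.symm k) a b
  rw [f.exists_congr_left, f'.exists_congr_left] at h₁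
  simpa only [hA, hB, hE, hF, Equiv.apply_symm_apply] using h₁

namespace BipartiteSMBData

/-- The bipartite data with the roles of `C` and `D` interchanged. -/
def symm {C D : Type} (B : BipartiteSMBData C D) : BipartiteSMBData D C where
  c := B.d
  d := B.c
  P := B.Q
  Q := B.P
  Xe := B.Ye
  Xo := B.Yo
  Ye := B.Xe
  Yo := B.Xo

/-- The properties of the blocks of a bipartite symbolic matrix bisystem. -/
structure IsProper {C D : Type} (B : BipartiteSMBData C D) : Prop where
  c_pos : ∀ l, 0 < B.c l
  d_pos : ∀ l, 0 < B.d l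
  P : ∀ l, IsResolving (B.P l)
  Q : ∀ l, IsResolving (B.Q l)
  Xe : ∀ l, IsResolving (B.Xe l)
  Xo : ∀ l, IsResolving (B.Xo l)
  Ye : ∀ l, IsResolving (B.Ye l)
  Yo : ∀ l, IsResolving (B.Yo l)
  YP : ∀ l, KappaRel (B.Yo l) (B.P (2 * l + 2)) (B.P (2 * l + 1)) (B.Ye (l + 1))
  XQ : ∀ l, KappaRel (B.Xo l) (B.Q (2 * l + 2)) (B.Q (2 * l + 1)) (B.Xe (l + 1))
  XP : ∀ l, KappaRel (B.Xe l) (B.P (2 * l + 1)) (B.P (2 * l)) (B.Xo l)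
  YQ : ∀ l, KappaRel (B.Ye l) (B.Q (2 * l + 1)) (B.Q (2 * l)) (B.Yo l)

namespace IsProper

theorem symm {C D : Type} {B : BipartiteSMBData C D} (h : B.IsProper) : B.symm.IsProper where
  c_pos := h.d_pos
  d_pos := h.c_pos
  P := h.Q
  Q := h.P
  Xe := h.Ye
  Xo := h.Yo
  Ye := h.Xe
  Yo := h.Xo
  YP := h.XQ
  XQ := h.YP
  XP := h.YQ
  YQ := h.XP

theorem kappaRel_MCD {C D : Type} {B : BipartiteSMBData C D} (h : B.IsProper) (l : ℕ) :
    KappaRel ((MCD B).Mm l) ((MCD B).Mp (l + 1)) ((MCD B).Mp l) ((MCD B).Mm (l + 1)) := by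
  intro i k x y
  constructor
  · rintro ⟨j, hm, hp⟩
    obtain ⟨j₁, hX, hY⟩ := mem_map_swap_symMul.1 hm
    obtain ⟨j₂, hP, hQ⟩ := (mem_symMul (A := B.P (2 * (l + 1)))).1 hp
    obtain ⟨k₁, hP, hY⟩ := (h.YP l j₁ j₂ x.1 y.1).1 ⟨j, hY, hP⟩
    obtain ⟨k₂, hP, hX⟩ := (h.XP l i k₁ x.2 y.1).1 ⟨j₁, hX, hP⟩
    obtain ⟨k₃, hQ, hY⟩ := (h.YQ (l + 1) k₁ k x.1 y.2).1 ⟨j₂, hY, hQ⟩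
    obtain ⟨k₄, hQ, hX⟩ := (h.XQ l k₂ k₃ x.2 y.2).1 ⟨k₁, hX, hQ⟩
    exact ⟨k₄, mem_symMul.2 ⟨k₂, hP, hQ⟩, mem_map_swap_symMul.2 ⟨k₃, hX, hY⟩⟩
  · rintro ⟨k₄, hp, hm⟩
    obtain ⟨k₂, hP, hQ⟩ := (mem_symMul (A := B.P (2 * l))).1 hp
    obtain ⟨k₃, hX, hY⟩ := mem_map_swap_symMul.1 hm
    obtain ⟨k₁, hX, hQ⟩ := (h.XQ l k₂ k₃ x.2 y.2).2 ⟨k₄, hQ, hX⟩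
    obtain ⟨j₂, hY, hQ⟩ := (h.YQ (l + 1) k₁ k x.1 y.2).2 ⟨k₃, hQ, hY⟩
    obtain ⟨j₁, hX, hP⟩ := (h.XP l i k₁ x.2 y.1).2 ⟨k₂, hP, hX⟩
    obtain ⟨j, hY, hP⟩ := (h.YP l j₁ j₂ x.1 y.1).2 ⟨k₁, hP, hY⟩
    exact ⟨j, mem_map_swap_symMul.2 ⟨j₁, hX, hY⟩, mem_symMul.2 ⟨j₂, hP, hQ⟩⟩

theorem isSMB_MCD {C D : Type} {B : BipartiteSMBData C D} (h : B.IsProper) :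
    IsSMB (MCD B) := by
  have hm : ∀ l, IsResolving ((MCD B).Mm l) := fun l =>
    ((h.Xe l).symMul (h.Yo l)).map Prod.swap_injective
  have hp : ∀ l, IsResolving ((MCD B).Mp l) := fun l =>
    (h.P (2 * l)).symMul (h.Q (2 * l + 1))
  exact
    { mpos := fun l => h.c_pos (2 * l)
      row_m := fun l => (hm l).row
      col_m := fun l => (hm l).col
      row_p := fun l => (hp l).row
      col_p := fun l => (hp l).col
      nodup_m := fun l => (hm l).nodup
      nodup_p := fun l => (hp l).nodup
      res_m := fun l => (hm l).res
      res_p := fun l => (hp l).res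
      commute := fun l => (h.kappaRel_MCD l).map_swap_eq (hm l) (hp _) (hp l) (hm _) }

theorem isSMB_MDC {C D : Type} {B : BipartiteSMBData C D} (h : B.IsProper) :
    IsSMB (MDC B) :=
  h.symm.isSMB_MCD

end IsProper

end BipartiteSMBData

/-- `splitIdx` as an equivalence. -/
def splitIdxEquiv {m a b : ℕ} (h : m = a + b) : Fin m ≃ Fin a ⊕ Fin b :=
  (finCongr h).trans finSumFinEquiv.symm

section Blocks

variable {C D : Type} {B : BipartiteSMBData C D}

theorem IsResolving.of_blockPlus {l : ℕ} (h : IsResolving (blockPlus B l)) :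
    IsResolving (B.P l) ∧ IsResolving (B.Q l) := by
  constructor
  · refine h.block (u := Sum.inl) (v := Sum.inr) (g := Sum.inl) Sum.inl_injective
      (fun _ _ => rfl) ?_ ?_
    · rintro i (j | j) <;> simp [blockPlus]
    · rintro (i | i) j <;> simp [blockPlus]
  · refine h.block (u := Sum.inr) (v := Sum.inl) (g := Sum.inr) Sum.inr_injective
      (fun _ _ => rfl) ?_ ?_
    · rintro i (j | j) <;> simp [blockPlus]
    · rintro (i | i) j <;> simp [blockPlus]

theorem IsResolving.of_blockMinusE {l : ℕ} (h : IsResolving (blockMinusE B l)) :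
    IsResolving (B.Xe l) ∧ IsResolving (B.Ye l) := by
  constructor
  · refine h.block (u := Sum.inl) (v := Sum.inl) (g := Sum.inr) Sum.inl_injective
      (fun _ _ => rfl) ?_ ?_
    · rintro i (j | j) <;> simp [blockMinusE]
    · rintro (i | i) j <;> simp [blockMinusE]
  · refine h.block (u := Sum.inr) (v := Sum.inr) (g := Sum.inl) Sum.inr_injective
      (fun _ _ => rfl) ?_ ?_
    · rintro i (j | j) <;> simp [blockMinusE]
    · rintro (i | i) j <;> simp [blockMinusE]

theorem IsResolving.of_blockMinusO {l : ℕ} (h : IsResolving (blockMinusO B l)) :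
    IsResolving (B.Yo l) ∧ IsResolving (B.Xo l) := by
  constructor
  · refine h.block (u := Sum.inl) (v := Sum.inl) (g := Sum.inl) Sum.inl_injective
      (fun _ _ => rfl) ?_ ?_
    · rintro i (j | j) <;> simp [blockMinusO]
    · rintro (i | i) j <;> simp [blockMinusO]
  · refine h.block (u := Sum.inr) (v := Sum.inr) (g := Sum.inr) Sum.inr_injective
      (fun _ _ => rfl) ?_ ?_
    · rintro i (j | j) <;> simp [blockMinusO]
    · rintro (i | i) j <;> simp [blockMinusO]

theorem KappaRel.of_blockMinusE {l : ℕ}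
    (h : KappaRel (blockMinusE B l) (blockPlus B (2 * l + 1)) (blockPlus B (2 * l))
      (blockMinusO B l)) :
    KappaRel (B.Xe l) (B.P (2 * l + 1)) (B.P (2 * l)) (B.Xo l) ∧
    KappaRel (B.Ye l) (B.Q (2 * l + 1)) (B.Q (2 * l)) (B.Yo l) := by
  constructor
  · intro i k a b
    simpa [blockMinusE, blockMinusO, blockPlus] using
      h (Sum.inl i) (Sum.inr k) (Sum.inr a) (Sum.inl b)
  · intro i k a b
    simpa [blockMinusE, blockMinusO, blockPlus] using
      h (Sum.inr i) (Sum.inl k) (Sum.inl a) (Sum.inr b)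

theorem KappaRel.of_blockMinusO {l : ℕ}
    (h : KappaRel (blockMinusO B l) (blockPlus B (2 * l + 2)) (blockPlus B (2 * l + 1))
      (blockMinusE B (l + 1))) :
    KappaRel (B.Yo l) (B.P (2 * l + 2)) (B.P (2 * l + 1)) (B.Ye (l + 1)) ∧
    KappaRel (B.Xo l) (B.Q (2 * l + 2)) (B.Q (2 * l + 1)) (B.Xe (l + 1)) := by
  constructor
  · intro i k a b
    simpa [blockMinusE, blockMinusO, blockPlus] using
      h (Sum.inl i) (Sum.inr k) (Sum.inl a) (Sum.inl b)
  · intro i k a b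
    simpa [blockMinusE, blockMinusO, blockPlus] using
      h (Sum.inr i) (Sum.inl k) (Sum.inr a) (Sum.inr b)

theorem IsSMB.isProper {M : SMBData (C ⊕ D) (C ⊕ D)} (hMs : IsSMB M)
    {hm : ∀ l, M.m l = B.c l + B.d l} (hbip : IsBipartiteWith M B hm) : B.IsProper := by
  obtain ⟨hp, he, ho⟩ := hbip
  have rp : ∀ l, IsResolving (M.Mp l) := fun l =>
    ⟨hMs.row_p l, hMs.col_p l, hMs.nodup_p l, hMs.res_p l⟩
  have rm : ∀ l, IsResolving (M.Mm l) := fun l =>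
    ⟨hMs.row_m l, hMs.col_m l, hMs.nodup_m l, hMs.res_m l⟩
  have hP : ∀ l, IsResolving (B.P l) ∧ IsResolving (B.Q l) := fun l =>
    ((rp l).reindex (splitIdxEquiv (hm l)) (splitIdxEquiv (hm (l + 1))) (hp l)).of_blockPlus
  have hE : ∀ l, IsResolving (B.Xe l) ∧ IsResolving (B.Ye l) := fun l =>
    ((rm (2 * l)).reindex (splitIdxEquiv (hm (2 * l))) (splitIdxEquiv (hm (2 * l + 1)))
      (he l)).of_blockMinusE
  have hO : ∀ l, IsResolving (B.Yo l) ∧ IsResolving (B.Xo l) := fun l =>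
    ((rm (2 * l + 1)).reindex (splitIdxEquiv (hm (2 * l + 1)))
      (splitIdxEquiv (hm (2 * l + 2))) (ho l)).of_blockMinusO
  have kE : ∀ l, KappaRel (blockMinusE B l) (blockPlus B (2 * l + 1)) (blockPlus B (2 * l))
      (blockMinusO B l) := fun l =>
    (kappaRel_of_map_swap_eq (hMs.commute (2 * l))).reindex
      (splitIdxEquiv (hm (2 * l))) (splitIdxEquiv (hm (2 * l + 1)))
      (splitIdxEquiv (hm (2 * l + 1))) (splitIdxEquiv (hm (2 * l + 2)))
      (he l) (hp (2 * l + 1)) (hp (2 * l)) (ho l)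
  have kO : ∀ l, KappaRel (blockMinusO B l) (blockPlus B (2 * l + 2))
      (blockPlus B (2 * l + 1)) (blockMinusE B (l + 1)) := fun l =>
    (kappaRel_of_map_swap_eq (hMs.commute (2 * l + 1))).reindex
      (splitIdxEquiv (hm (2 * l + 1))) (splitIdxEquiv (hm (2 * l + 2)))
      (splitIdxEquiv (hm (2 * l + 2))) (splitIdxEquiv (hm (2 * l + 3)))
      (ho l) (hp (2 * l + 2)) (hp (2 * l + 1)) (he (l + 1))
  have cd : ∀ l, 0 < B.c l → 0 < B.d (l + 1) := fun l h =>
    ((hP l).1.row ⟨0, h⟩).choose.pos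
  have dc : ∀ l, 0 < B.d l → 0 < B.c (l + 1) := fun l h =>
    ((hP l).2.row ⟨0, h⟩).choose.pos
  have cd' : ∀ l, 0 < B.c (l + 1) → 0 < B.d l := fun l h =>
    ((hP l).2.col ⟨0, h⟩).choose.pos
  have dc' : ∀ l, 0 < B.d (l + 1) → 0 < B.c l := fun l h =>
    ((hP l).1.col ⟨0, h⟩).choose.pos
  have cc : ∀ l, 0 < B.c (2 * l) → 0 < B.c (2 * l + 1) := fun l h =>
    ((hE l).1.row ⟨0, h⟩).choose.pos
  have dd : ∀ l, 0 < B.d (2 * l) → 0 < B.d (2 * l + 1) := fun l h =>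
    ((hE l).2.row ⟨0, h⟩).choose.pos
  have even_pos : ∀ l, 0 < B.c (2 * l) ∧ 0 < B.d (2 * l) := by
    intro l
    have h := hMs.mpos (2 * l)
    rw [hm] at h
    rcases Nat.eq_zero_or_pos (B.c (2 * l)) with h₀ | h₀
    · have hd : 0 < B.d (2 * l) := by omega
      exact ⟨dc' _ (dd l hd), hd⟩
    · exact ⟨h₀, cd' _ (cc l h₀)⟩
  have pos : ∀ l, 0 < B.c l ∧ 0 < B.d l := by
    intro l
    obtain ⟨k, rfl | rfl⟩ := l.even_or_odd'
    · exact even_pos k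
    · exact ⟨dc _ (even_pos k).2, cd _ (even_pos k).1⟩
  exact
    { c_pos := fun l => (pos l).1
      d_pos := fun l => (pos l).2
      P := fun l => (hP l).1
      Q := fun l => (hP l).2
      Xe := fun l => (hE l).1
      Xo := fun l => (hO l).2
      Ye := fun l => (hE l).2
      Yo := fun l => (hO l).1
      YP := fun l => (kO l).of_blockMinusO.1
      XQ := fun l => (kO l).of_blockMinusO.2
      XP := fun l => (kE l).of_blockMinusE.1
      YQ := fun l => (kE l).of_blockMinusE.2 }

end Blocks

/-- for a bipartite symbolic matrix bisystem with bipartite data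
`P, Q, X, Y`, the pairs `(M^{CD-}, M^{CD+})` and `(M^{DC-}, M^{DC+})` are symbolic
matrix bisystems over `C·D` and `D·C` which are properly strong shift equivalent in
1-step, witnessed by the matrices `P_l, Q_l, X_l, Y_l`; in particular
`Y_l P_{l+1} ≃_κ P_l Y_{l+1}` and `X_l Q_{l+1} ≃_κ Q_l X_{l+1}` for `l` odd, and
`X_l P_{l+1} ≃_κ P_l X_{l+1}` and `Y_l Q_{l+1} ≃_κ Q_l Y_{l+1}` for `l` even. -/
theorem stmt_7 {C D : Type} (M : SMBData (C ⊕ D) (C ⊕ D)) (hMs : IsSMB M)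
    (B : BipartiteSMBData C D) (hm : ∀ l, M.m l = B.c l + B.d l)
    (hbip : IsBipartiteWith M B hm) :
    IsSMB (MCD B) ∧ IsSMB (MDC B) ∧
    (∀ l i j, (symMul (B.Yo l) (B.P (2 * l + 2)) i j).map Prod.swap =
      symMul (B.P (2 * l + 1)) (B.Ye (l + 1)) i j) ∧
    (∀ l i j, (symMul (B.Xo l) (B.Q (2 * l + 2)) i j).map Prod.swap =
      symMul (B.Q (2 * l + 1)) (B.Xe (l + 1)) i j) ∧
    (∀ l i j, (symMul (B.Xe l) (B.P (2 * l + 1)) i j).map Prod.swap =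
      symMul (B.P (2 * l)) (B.Xo l) i j) ∧
    (∀ l i j, (symMul (B.Ye l) (B.Q (2 * l + 1)) i j).map Prod.swap =
      symMul (B.Q (2 * l)) (B.Yo l) i j) ∧
    Nonempty (PSSE1Data C D (MCD B) (MDC B)) := by
  have h := hMs.isProper hbip
  have hYP := fun l => (h.YP l).map_swap_eq (h.Yo l) (h.P _) (h.P _) (h.Ye _)
  have hXQ := fun l => (h.XQ l).map_swap_eq (h.Xo l) (h.Q _) (h.Q _) (h.Xe _)
  have hXP := fun l => (h.XP l).map_swap_eq (h.Xe l) (h.P _) (h.P _) (h.Xo _)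
  have hYQ := fun l => (h.YQ l).map_swap_eq (h.Ye l) (h.Q _) (h.Q _) (h.Yo _)
  refine ⟨h.isSMB_MCD, h.isSMB_MDC, hYP, hXQ, hXP, hYQ, ⟨?_⟩⟩
  exact
    { φ := id
      ψ := id
      φ_inj := Function.injective_id
      ψ_inj := Function.injective_id
      c := B.c
      d := B.d
      hc := fun _ => rfl
      hd := fun _ => rfl
      P := B.P
      Q := B.Q
      Xe := B.Xe
      Xo := B.Xo
      Ye := B.Ye
      Yo := B.Yo
      hMp := fun _ _ _ => Multiset.map_id _
      hNp := fun _ _ _ => Multiset.map_id _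
      hMm := fun _ _ _ => by
        simp only [MCD, Multiset.map_map, Function.comp_id, Prod.swap_swap_eq, Multiset.map_id]
        rfl
      hNm := fun _ _ _ => by
        simp only [MDC, Multiset.map_map, Function.comp_id, Prod.swap_swap_eq, Multiset.map_id]
        rfl
      hYP := hYP
      hXQ := hXQ
      hXP := hXP
      hYQ := hYQ }
end

section
/- Let Λ be a nonempty bipartite subshift with respect to disjoint alphabets C, D. Then the canonical symbolic matrix bisystems of the subshifts Λ_{CD} (over C·D) and Λ_{DC} (over D·C) are properly strong shift equivalent in 1-step. -/
/-- The shift homeomorphism `σ` on the full shift: `(σ x) n = x (n+1)`. -/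
def shiftMap {A : Type} (x : ℤ → A) : ℤ → A := fun n => x (n + 1)

/-- A subshift: a closed, shift-invariant subset of the full shift `A^ℤ`
(with `A` carrying the discrete topology and `A^ℤ` the product topology). -/
def IsSubshift {A : Type} [TopologicalSpace A] (Λ : Set (ℤ → A)) : Prop :=
  IsClosed Λ ∧ shiftMap '' Λ = Λ

/-- Replace the coordinates strictly between `k` and `l` of `x` by those of `μ`. -/
def splice {A : Type} (x : ℤ → A) (k l : ℤ) (μ : ℤ → A) : ℤ → A :=
  fun n => if k < n ∧ n < l then μ n else x n

/-- `W_{k,l}(x)`: the set of words (recorded on the coordinates strictly between `k`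
and `l`) which can be inserted between `x_{(-∞,k]}` and `x_{[l,∞)}` inside `Λ`. -/
def WSet {A : Type} (Λ : Set (ℤ → A)) (k l : ℤ) (x : ℤ → A) : Set (ℤ → A) :=
  { μ | splice x k l μ ∈ Λ }
/-- The underlying data of a λ-graph bisystem `(L⁻, L⁺)` over alphabets `Sm, Sp`:
common vertex sets `V l`, upward edges `Em l = E⁻_{l+1,l}` (source in `V (l+1)`,
terminal in `V l`) labeled in `Sm`, and downward edges `Ep l = E⁺_{l,l+1}`
(source in `V l`, terminal in `V (l+1)`) labeled in `Sp`. -/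
structure LGBSData (Sm Sp : Type) where
  V : ℕ → Type
  Em : ℕ → Type
  sm : ∀ l, Em l → V (l + 1)
  tm : ∀ l, Em l → V l
  lm : ∀ l, Em l → Sm
  Ep : ℕ → Type
  sp : ∀ l, Ep l → V l
  tp : ∀ l, Ep l → V (l + 1)
  lp : ∀ l, Ep l → Sp

/-- The axioms making the data `L` a λ-graph bisystem: finite nonempty vertex sets,
finitely many edges, every vertex has the required incoming and outgoing edges,
`λ⁻` is right-resolving, `λ⁺` is left-resolving, and the local property holds. -/
structure IsLGBS {Sm Sp : Type} (L : LGBSData Sm Sp) : Prop where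
  Vfin : ∀ l, Finite (L.V l)
  Vne : ∀ l, Nonempty (L.V l)
  Emfin : ∀ l, Finite (L.Em l)
  Epfin : ∀ l, Finite (L.Ep l)
  sm_surj : ∀ l, Function.Surjective (L.sm l)
  tm_surj : ∀ l, Function.Surjective (L.tm l)
  sp_surj : ∀ l, Function.Surjective (L.sp l)
  tp_surj : ∀ l, Function.Surjective (L.tp l)
  right_resolving : ∀ l (e f : L.Em l), L.sm l e = L.sm l f → L.lm l e = L.lm l f → e = f
  left_resolving : ∀ l (e f : L.Ep l), L.tp l e = L.tp l f → L.lp l e = L.lp l f → e = f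
  local_property : ∀ (l : ℕ) (u : L.V l) (v : L.V (l + 2)),
    ∃ φ : { p : L.Em l × L.Ep (l + 1) //
              L.tm l p.1 = u ∧ L.sm l p.1 = L.sp (l + 1) p.2 ∧ L.tp (l + 1) p.2 = v } ≃
          { q : L.Ep l × L.Em (l + 1) //
              L.sp l q.1 = u ∧ L.tp l q.1 = L.tm (l + 1) q.2 ∧ L.sm (l + 1) q.2 = v },
      ∀ p, L.lm l p.1.1 = L.lm (l + 1) (φ p).1.2 ∧ L.lp (l + 1) p.1.2 = L.lp l (φ p).1.1
/-- The `(k,l)`-central equivalence relation on the points of `Λ`. -/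
def cSetoid {A : Type} (Λ : Set (ℤ → A)) (k l : ℤ) : Setoid ↥Λ where
  r x y := WSet Λ k l x.1 = WSet Λ k l y.1
  iseqv := ⟨fun _ => rfl, Eq.symm, Eq.trans⟩

/-- Powers of the shift: `(shiftZ t x) n = x (n + t)`. -/
def shiftZ {A : Type} (t : ℤ) (x : ℤ → A) : ℤ → A := fun n => x (n + t)

/-- The vertex set `V_l = Ω^c_{-l,1}` of the canonical λ-graph bisystem of `Λ`. -/
abbrev Vq {A : Type} (Λ : Set (ℤ → A)) (l : ℕ) : Type := Quotient (cSetoid Λ (-(l : ℤ)) 1)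

/-- The relation defining the labeled edges of the canonical `L_Λ⁻`: there is an edge
labeled `β` from the class `c'` (at level `l+1`) down to the class `c` (at level `l`)
iff `C' β ⊆ C`, i.e. inserting `β` (followed by a suitable word) just after
coordinate `-(l+1)` of a representative of `c'` produces a point of the class `c`. -/
def minusRel {A : Type} (Λ : Set (ℤ → A)) (l : ℕ) (β : A)
    (c' : Vq Λ (l + 1)) (c : Vq Λ l) : Prop :=
  ∃ y : ↥Λ, Quotient.mk (cSetoid Λ (-((l + 1 : ℕ) : ℤ)) 1) y = c' ∧
    ∃ (v : ℤ → A) (h : splice y.1 (-((l + 1 : ℕ) : ℤ)) 1 v ∈ Λ),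
      v (-(l : ℤ)) = β ∧
      Quotient.mk (cSetoid Λ (-(l : ℤ)) 1) ⟨splice y.1 (-((l + 1 : ℕ) : ℤ)) 1 v, h⟩ = c

/-- The relation defining the labeled edges of the canonical `L_Λ⁺`: there is an edge
labeled `α` from the class `c` (at level `l`) to the class `c'` (at level `l+1`) iff
`α C' ⊆ C`, i.e. (after the identification `Ω^c_{-(l+1),1} ≅ Ω^c_{-1,l+1}` given by
`σ^{-l}`) inserting a suitable word ending with `α` just before coordinate `l+1` of a
representative of `c'` produces (after shifting back by `σ^{l-1}`) a point of `c`. -/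
def plusRel {A : Type} (Λ : Set (ℤ → A)) (l : ℕ) (α : A)
    (c : Vq Λ l) (c' : Vq Λ (l + 1)) : Prop :=
  ∃ y : ↥Λ, Quotient.mk (cSetoid Λ (-((l + 1 : ℕ) : ℤ)) 1) y = c' ∧
    ∃ (v : ℤ → A) (h : splice (shiftZ (-(l : ℤ)) y.1) (-1) ((l : ℤ) + 1) v ∈ Λ),
      v (l : ℤ) = α ∧
      ∃ h2 : shiftZ ((l : ℤ) - 1) (splice (shiftZ (-(l : ℤ)) y.1) (-1) ((l : ℤ) + 1) v) ∈ Λ,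
        Quotient.mk (cSetoid Λ (-(l : ℤ)) 1)
          ⟨shiftZ ((l : ℤ) - 1) (splice (shiftZ (-(l : ℤ)) y.1) (-1) ((l : ℤ) + 1) v), h2⟩ = c

/-- The data of the canonical λ-graph bisystem `(L_Λ⁻, L_Λ⁺)` of a subshift `Λ`,
built from the central equivalence classes of `Λ`. -/
def canonicalLGBS {A : Type} (Λ : Set (ℤ → A)) : LGBSData A A where
  V := fun l => Vq Λ l
  Em := fun l => { p : Vq Λ (l + 1) × A × Vq Λ l // minusRel Λ l p.2.1 p.1 p.2.2 }
  sm := fun _ e => e.1.1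
  tm := fun _ e => e.1.2.2
  lm := fun _ e => e.1.2.1
  Ep := fun l => { p : Vq Λ l × A × Vq Λ (l + 1) // plusRel Λ l p.2.1 p.1 p.2.2 }
  sp := fun _ e => e.1.1
  tp := fun _ e => e.1.2.2
  lp := fun _ e => e.1.2.1
/-- `M` is a matrix presentation of the λ-graph bisystem `L`: under some enumerations
of the vertex sets, the entry `M⁻_{l,l+1}(i,j)` is the formal sum of the labels of
the `E⁻_{l+1,l}`-edges from `v_j^{l+1}` to `v_i^l`, and `M⁺_{l,l+1}(i,j)` the formal
sum of the labels of the `E⁺_{l,l+1}`-edges from `v_i^l` to `v_j^{l+1}`. -/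
def Presents {S : Type} (M : SMBData S S) (L : LGBSData S S) : Prop :=
  ∃ e : ∀ l, L.V l ≃ Fin (M.m l),
    (∀ l (i : Fin (M.m l)) (j : Fin (M.m (l + 1))),
      (M.Mm l i j).Nodup ∧
      ∀ a : S, a ∈ M.Mm l i j ↔
        ∃ ed : L.Em l, L.sm l ed = (e (l + 1)).symm j ∧ L.tm l ed = (e l).symm i ∧
          L.lm l ed = a) ∧
    (∀ l (i : Fin (M.m l)) (j : Fin (M.m (l + 1))),
      (M.Mp l i j).Nodup ∧
      ∀ a : S, a ∈ M.Mp l i j ↔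
        ∃ ed : L.Ep l, L.sp l ed = (e l).symm i ∧ L.tp l ed = (e (l + 1)).symm j ∧
          L.lp l ed = a)
/-- A subshift is bipartite with respect to the partition `Σ = C ⊔ D`: every point
alternates between `C` and `D`, i.e. has its `C`-letters either exactly at the even
coordinates or exactly at the odd coordinates. -/
def BipartiteWith {A : Type} (Λ : Set (ℤ → A)) (C D : Set A) : Prop :=
  ∀ x ∈ Λ,
    (∀ n : ℤ, (Even n → x n ∈ C) ∧ (Odd n → x n ∈ D)) ∨
    (∀ n : ℤ, (Even n → x n ∈ D) ∧ (Odd n → x n ∈ C))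

/-- A bipartite subshift. -/
def BipartiteSubshift {A : Type} (Λ : Set (ℤ → A)) : Prop :=
  ∃ C D : Set A, Disjoint C D ∧ C ∪ D = Set.univ ∧ BipartiteWith Λ C D

/-- Interleave a sequence of two-letter blocks into a bi-infinite sequence:
the first components occupy the even coordinates, the second the odd ones. -/
def interleave {A P Q : Type} (f : P → A) (g : Q → A) (y : ℤ → P × Q) : ℤ → A :=
  fun n => if n % 2 = 0 then f (y (n / 2)).1 else g (y (n / 2)).2

/-- The subshift `Λ_{CD}` over the alphabet `C·D` associated to a bipartite subshift. -/
def LambdaCD {A : Type} (Λ : Set (ℤ → A)) (C D : Set A) : Set (ℤ → ↥C × ↥D) :=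
  { y | interleave Subtype.val Subtype.val y ∈ Λ }

/-- The subshift `Λ_{DC}` over the alphabet `D·C` associated to a bipartite subshift. -/
def LambdaDC {A : Type} (Λ : Set (ℤ → A)) (C D : Set A) : Set (ℤ → ↥D × ↥C) :=
  { y | interleave Subtype.val Subtype.val y ∈ Λ }

section Words

variable {A : Type}

/-- The word `z_k z_{k+1} ⋯ z_{k+n-1}`. -/
def word (z : ℤ → A) (k : ℤ) (n : ℕ) : List A := (List.range n).map fun i : ℕ => z (k + i)

theorem word_succ (z : ℤ → A) (k : ℤ) (n : ℕ) :
    word z k (n + 1) = word z k n ++ [z (k + n)] := by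
  simp [word, List.range_succ]

theorem word_succ' (z : ℤ → A) (k : ℤ) (n : ℕ) :
    word z k (n + 1) = z k :: word z (k + 1) n := by
  simp only [word, List.range_succ_eq_map, List.map_cons, List.map_map, Nat.cast_zero, add_zero]
  congr 1
  refine List.map_congr_left fun i _ => ?_
  simp only [Function.comp, Nat.succ_eq_add_one]
  congr 1
  push_cast
  ring

theorem length_word (z : ℤ → A) (k : ℤ) (n : ℕ) : (word z k n).length = n := by
  simp [word]

theorem word_eq_word_iff {z z' : ℤ → A} {k k' : ℤ} {n : ℕ} :
    word z k n = word z' k' n ↔ ∀ i : ℕ, i < n → z (k + i) = z' (k' + i) := by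
  simp [word]

/-- The language of words of length `n` that can replace `x_k ⋯ x_{k+n-1}` inside `Λ`. -/
def lang (Λ : Set (ℤ → A)) (x : ℤ → A) (k : ℤ) (n : ℕ) : Set (List A) :=
  {w | ∃ z ∈ Λ, (∀ m, m < k ∨ k + n ≤ m → z m = x m) ∧ word z k n = w}

/-- The words that can be preceded by `b` in `L`. -/
def leftQuot (b : A) (L : Set (List A)) : Set (List A) := {w | b :: w ∈ L}

/-- The words that can be followed by `a` in `L`. -/
def rightQuot (a : A) (L : Set (List A)) : Set (List A) := {w | w ++ [a] ∈ L}

theorem leftQuot_empty (b : A) : leftQuot b ∅ = ∅ := rfl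

theorem rightQuot_empty (a : A) : rightQuot a ∅ = ∅ := rfl

theorem leftQuot_rightQuot (a b : A) (L : Set (List A)) :
    leftQuot b (rightQuot a L) = rightQuot a (leftQuot b L) := rfl

theorem lang_nonempty {Λ : Set (ℤ → A)} {x : ℤ → A} (hx : x ∈ Λ) (k : ℤ) (n : ℕ) :
    (lang Λ x k n).Nonempty :=
  ⟨_, x, hx, fun _ _ => rfl, rfl⟩

theorem word_mem_lang_iff {Λ : Set (ℤ → A)} {x μ : ℤ → A} {k : ℤ} {n : ℕ} :
    word μ k n ∈ lang Λ x k n ↔ splice x (k - 1) (k + n) μ ∈ Λ := by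
  constructor
  · rintro ⟨z, hz, hzx, hw⟩
    convert hz using 1
    ext m
    unfold splice
    split_ifs with h
    · have := word_eq_word_iff.1 hw (m - k).toNat (by omega)
      rw [show k + ((m - k).toNat : ℤ) = m by omega] at this
      exact this.symm
    · exact (hzx m (by omega)).symm
  · intro h
    refine ⟨_, h, fun m hm => ?_, word_eq_word_iff.2 fun i hi => ?_⟩
    · exact if_neg (by omega)
    · exact if_pos (by omega)

theorem splice_of_mem {x μ : ℤ → A} {k l m : ℤ} (h : k < m ∧ m < l) :
    splice x k l μ m = μ m := if_pos h

theorem splice_of_notMem {x μ : ℤ → A} {k l m : ℤ} (h : ¬(k < m ∧ m < l)) :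
    splice x k l μ m = x m := if_neg h

theorem lang_eq_of_agree (Λ : Set (ℤ → A)) {x z : ℤ → A} {k : ℤ} {n : ℕ}
    (hzx : ∀ m, m < k ∨ k + n ≤ m → z m = x m) : lang Λ z k n = lang Λ x k n := by
  ext w
  constructor <;> rintro ⟨u, hu, h, rfl⟩
  · exact ⟨u, hu, fun m hm => (h m hm).trans (hzx m hm), rfl⟩
  · exact ⟨u, hu, fun m hm => (h m hm).trans (hzx m hm).symm, rfl⟩

theorem lang_eq_leftQuot_self (Λ : Set (ℤ → A)) (z : ℤ → A) (k : ℤ) (n : ℕ) :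
    lang Λ z (k + 1) n = leftQuot (z k) (lang Λ z k (n + 1)) := by
  ext w
  constructor
  · rintro ⟨u, hu, h, rfl⟩
    refine ⟨u, hu, fun m hm => h m (by push_cast at hm; omega), ?_⟩
    rw [word_succ', h k (by omega)]
  · rintro ⟨u, hu, h, hw⟩
    rw [word_succ', List.cons.injEq] at hw
    refine ⟨u, hu, fun m hm => ?_, hw.2⟩
    rcases eq_or_ne m k with rfl | hmk
    · exact hw.1
    · exact h m (by push_cast; omega)

theorem lang_eq_rightQuot_self (Λ : Set (ℤ → A)) (z : ℤ → A) (k : ℤ) (n : ℕ) :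
    lang Λ z k n = rightQuot (z (k + n)) (lang Λ z k (n + 1)) := by
  ext w
  constructor
  · rintro ⟨u, hu, h, rfl⟩
    refine ⟨u, hu, fun m hm => h m (by push_cast at hm; omega), ?_⟩
    rw [word_succ, h (k + n) (by omega)]
  · rintro ⟨u, hu, h, hw⟩
    rw [word_succ] at hw
    obtain ⟨hw, hlast⟩ := List.append_inj' hw rfl
    refine ⟨u, hu, fun m hm => ?_, hw⟩
    rcases eq_or_ne m (k + n) with rfl | hmk
    · simpa using hlast
    · exact h m (by push_cast; omega)

theorem shiftZ_add (s t : ℤ) (x : ℤ → A) : shiftZ s (shiftZ t x) = shiftZ (s + t) x := by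
  ext n
  simp [shiftZ, add_assoc]

theorem shiftZ_zero (x : ℤ → A) : shiftZ 0 x = x := by
  ext n
  simp [shiftZ]

theorem lang_shiftZ_subset {Λ : Set (ℤ → A)} (hΛ : ∀ t, ∀ x ∈ Λ, shiftZ t x ∈ Λ)
    (t : ℤ) (x : ℤ → A) (k : ℤ) (n : ℕ) :
    lang Λ x (k + t) n ⊆ lang Λ (shiftZ t x) k n := by
  rintro w ⟨z, hz, h, rfl⟩
  refine ⟨shiftZ t z, hΛ t z hz, fun m hm => h _ (by omega), word_eq_word_iff.2 fun i _ => ?_⟩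
  simp only [shiftZ]
  congr 1
  ring

theorem lang_shiftZ {Λ : Set (ℤ → A)} (hΛ : ∀ t, ∀ x ∈ Λ, shiftZ t x ∈ Λ)
    (t : ℤ) (x : ℤ → A) (k : ℤ) (n : ℕ) :
    lang Λ (shiftZ t x) k n = lang Λ x (k + t) n := by
  refine Set.Subset.antisymm ?_ (lang_shiftZ_subset hΛ t x k n)
  have := lang_shiftZ_subset hΛ (-t) (shiftZ t x) (k + t) n
  rwa [shiftZ_add, neg_add_cancel, shiftZ_zero, add_neg_cancel_right] at this

theorem shiftZ_mem_of_shiftMap_image_eq {Λ : Set (ℤ → A)} (hΛ : shiftMap '' Λ = Λ)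
    (t : ℤ) (x : ℤ → A) (hx : x ∈ Λ) : shiftZ t x ∈ Λ := by
  induction t with
  | zero => rwa [shiftZ_zero]
  | succ n ih =>
    have : shiftZ ((n : ℤ) + 1) x = shiftMap (shiftZ n x) := by
      ext m
      simp only [shiftZ, shiftMap]
      congr 1
      ring
    rw [this, ← hΛ]
    exact Set.mem_image_of_mem _ ih
  | pred n ih =>
    rw [← hΛ] at ih
    obtain ⟨z, hz, hzx⟩ := ih
    convert hz using 1
    ext m
    have := congrFun hzx (m - 1)
    simp only [shiftMap, shiftZ, sub_add_cancel] at this ⊢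
    rw [this]
    congr 1
    ring

end Words

section CanonicalBisystem

variable {S : Type} {Γ : Set (ℤ → S)}

theorem wSet_eq_iff_lang_eq (l : ℕ) (x y : ℤ → S) :
    WSet Γ (-(l : ℤ)) 1 x = WSet Γ (-(l : ℤ)) 1 y ↔
      lang Γ x (1 - l) l = lang Γ y (1 - l) l := by
  have key : ∀ u μ : ℤ → S,
      μ ∈ WSet Γ (-(l : ℤ)) 1 u ↔ word μ (1 - l) l ∈ lang Γ u (1 - l) l := by
    intro u μ
    rw [word_mem_lang_iff, show (1 : ℤ) - l - 1 = -l by ring,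
      show (1 : ℤ) - l + l = 1 by ring]
    rfl
  constructor
  · intro h
    ext w
    constructor <;> intro hw <;> obtain ⟨z, -, -, rfl⟩ := id hw
    · exact (key y z).1 (h ▸ (key x z).2 hw)
    · exact (key x z).1 (h ▸ (key y z).2 hw)
  · intro h
    ext μ
    rw [key, key, h]

/-- The language of words filling the gap of a central equivalence class. -/
def classLang (Γ : Set (ℤ → S)) (l : ℕ) : Vq Γ l → Set (List S) :=
  Quotient.lift (fun y => lang Γ y.1 (1 - l) l) fun x y h =>
    (wSet_eq_iff_lang_eq l x.1 y.1).1 h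

theorem classLang_mk (l : ℕ) (y : ↥Γ) :
    classLang Γ l (Quotient.mk (cSetoid Γ (-(l : ℤ)) 1) y) = lang Γ y.1 (1 - l) l := rfl

theorem classLang_injective (l : ℕ) : Function.Injective (classLang Γ l) := by
  intro c c'
  induction c using Quotient.inductionOn
  induction c' using Quotient.inductionOn
  intro h
  exact Quotient.sound ((wSet_eq_iff_lang_eq l _ _).2 h)

theorem classLang_nonempty (l : ℕ) (c : Vq Γ l) : (classLang Γ l c).Nonempty := by
  induction c using Quotient.inductionOn
  exact lang_nonempty (Subtype.property _) _ _

theorem minusRel_iff (l : ℕ) (β : S) (c' : Vq Γ (l + 1)) (c : Vq Γ l) :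
    minusRel Γ l β c' c ↔ classLang Γ l c = leftQuot β (classLang Γ (l + 1) c') := by
  have key : ∀ y z : ℤ → S, (∀ m : ℤ, m < -l ∨ 1 ≤ m → z m = y m) →
      lang Γ z (1 - l) l = leftQuot (z (-l)) (lang Γ y (1 - (l + 1 : ℕ)) (l + 1)) := by
    intro y z h
    rw [show (1 : ℤ) - (l + 1 : ℕ) = -l by push_cast; ring,
      ← lang_eq_of_agree Γ fun m hm => h m (by push_cast at hm; omega),
      ← lang_eq_leftQuot_self, neg_add_eq_sub]
  constructor
  · rintro ⟨y, rfl, v, h, rfl, rfl⟩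
    rw [classLang_mk, classLang_mk, key y.1 _ fun m hm => splice_of_notMem (by push_cast; omega),
      splice_of_mem (by push_cast; omega)]
  · intro h
    obtain ⟨y, rfl⟩ := Quotient.exists_rep c'
    obtain ⟨w, hw⟩ := classLang_nonempty l c
    rw [h, classLang_mk] at hw
    obtain ⟨z, hz, hzy, hzw⟩ := hw
    rw [word_succ', List.cons.injEq] at hzw
    rw [show (1 : ℤ) - (l + 1 : ℕ) = -l by push_cast; ring] at hzy hzw
    have hzy' : ∀ m : ℤ, m < -l ∨ 1 ≤ m → z m = y.1 m :=
      fun m hm => hzy m (by push_cast; omega)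
    have hs : splice y.1 (-((l + 1 : ℕ) : ℤ)) 1 z = z := by
      ext m
      unfold splice
      split_ifs with hm
      · rfl
      · exact (hzy' m (by push_cast at hm; omega)).symm
    refine ⟨y, rfl, z, hs.symm ▸ hz, hzw.1, classLang_injective l ?_⟩
    rw [h, classLang_mk, classLang_mk]
    simp only [hs]
    rw [key y.1 z hzy', hzw.1]

theorem plusRel_iff (hΓ : ∀ t, ∀ x ∈ Γ, shiftZ t x ∈ Γ) (l : ℕ) (α : S)
    (c : Vq Γ l) (c' : Vq Γ (l + 1)) :
    plusRel Γ l α c c' ↔ classLang Γ l c = rightQuot α (classLang Γ (l + 1) c') := by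
  have key : ∀ y z : ℤ → S, (∀ m : ℤ, m < 0 ∨ l + 1 ≤ m → z m = shiftZ (-(l : ℤ)) y m) →
      lang Γ (shiftZ ((l : ℤ) - 1) z) (1 - l) l =
        rightQuot (z l) (lang Γ y (1 - (l + 1 : ℕ)) (l + 1)) := by
    intro y z h
    rw [show (1 : ℤ) - (l + 1 : ℕ) = 0 + -l by push_cast; ring, ← lang_shiftZ hΓ,
      ← lang_eq_of_agree Γ fun m hm => h m (by push_cast at hm; omega), lang_shiftZ hΓ,
      show (1 : ℤ) - l + (l - 1) = 0 by ring, lang_eq_rightQuot_self, zero_add]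
  constructor
  · rintro ⟨y, rfl, v, h, rfl, h2, rfl⟩
    rw [classLang_mk, classLang_mk, key y.1 _ fun m hm => splice_of_notMem (by omega),
      splice_of_mem (by omega)]
  · intro h
    obtain ⟨y, rfl⟩ := Quotient.exists_rep c'
    obtain ⟨w, hw⟩ := classLang_nonempty l c
    rw [h, classLang_mk, show (1 : ℤ) - (l + 1 : ℕ) = 0 + -l by push_cast; ring,
      ← lang_shiftZ hΓ] at hw
    obtain ⟨z, hz, hzy, hzw⟩ := hw
    rw [word_succ] at hzw
    have hα : z l = α := by simpa using (List.append_inj' hzw rfl).2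
    have hzy' : ∀ m : ℤ, m < 0 ∨ l + 1 ≤ m → z m = shiftZ (-(l : ℤ)) y.1 m :=
      fun m hm => hzy m (by push_cast; omega)
    have hs : splice (shiftZ (-(l : ℤ)) y.1) (-1) ((l : ℤ) + 1) z = z := by
      ext m
      unfold splice
      split_ifs with hm
      · rfl
      · exact (hzy' m (by omega)).symm
    refine ⟨y, rfl, z, hs.symm ▸ hz, hα, hs.symm ▸ hΓ _ _ hz, classLang_injective l ?_⟩
    rw [h, classLang_mk, classLang_mk]
    simp only [hs]
    rw [key y.1 z hzy', hα]

theorem Presents.exists_equiv {M : SMBData S S} (hM : Presents M (canonicalLGBS Γ)) :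
    ∃ e : ∀ l, Vq Γ l ≃ Fin (M.m l),
      (∀ l i j, (M.Mm l i j).Nodup ∧
        ∀ a, a ∈ M.Mm l i j ↔ minusRel Γ l a ((e (l + 1)).symm j) ((e l).symm i)) ∧
      (∀ l i j, (M.Mp l i j).Nodup ∧
        ∀ a, a ∈ M.Mp l i j ↔ plusRel Γ l a ((e l).symm i) ((e (l + 1)).symm j)) := by
  obtain ⟨e, hm, hp⟩ := hM
  refine ⟨e, fun l i j => ⟨(hm l i j).1, fun a => ((hm l i j).2 a).trans ⟨?_, ?_⟩⟩,
    fun l i j => ⟨(hp l i j).1, fun a => ((hp l i j).2 a).trans ⟨?_, ?_⟩⟩⟩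
  · rintro ⟨⟨⟨c', b, c⟩, h⟩, h1, h2, h3⟩
    cases h1
    cases h2
    cases h3
    exact h
  · exact fun h => ⟨⟨(_, a, _), h⟩, rfl, rfl, rfl⟩
  · rintro ⟨⟨⟨c, b, c'⟩, h⟩, h1, h2, h3⟩
    cases h1
    cases h2
    cases h3
    exact h
  · exact fun h => ⟨⟨(_, a, _), h⟩, rfl, rfl, rfl⟩

end CanonicalBisystem

section Blocks

variable {A : Type} {B B' : Set A}

/-- Concatenate a word of two-letter blocks. -/
def flattenBlocks (w : List (↥B × ↥B')) : List A := w.flatMap fun p => [p.1.1, p.2.1]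

theorem flattenBlocks_cons (p : ↥B × ↥B') (w : List (↥B × ↥B')) :
    flattenBlocks (p :: w) = p.1.1 :: p.2.1 :: flattenBlocks w := rfl

theorem flattenBlocks_concat (p : ↥B × ↥B') (w : List (↥B × ↥B')) :
    flattenBlocks (w ++ [p]) = flattenBlocks w ++ [p.1.1] ++ [p.2.1] := by
  simp [flattenBlocks]

theorem flattenBlocks_injective :
    Function.Injective (flattenBlocks : List (↥B × ↥B') → List A) := by
  intro w
  induction w with
  | nil =>
    intro w' h
    cases w' with
    | nil => rfl
    | cons p w' => exact absurd h (by simp [flattenBlocks])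
  | cons p w ih =>
    intro w' h
    cases w' with
    | nil => exact absurd h (by simp [flattenBlocks])
    | cons q w' =>
      simp only [flattenBlocks_cons, List.cons.injEq] at h
      rw [ih h.2.2, Prod.ext (Subtype.ext h.1) (Subtype.ext h.2.1)]

theorem leftQuot_leftQuot_flattenBlocks_image (p : ↥B × ↥B') (T : Set (List (↥B × ↥B'))) :
    leftQuot p.2.1 (leftQuot p.1.1 (flattenBlocks '' T)) = flattenBlocks '' leftQuot p T := by
  ext w
  constructor
  · rintro ⟨s, hs, h⟩
    cases s with
    | nil => exact absurd h (by simp [flattenBlocks])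
    | cons q s =>
      simp only [flattenBlocks_cons, List.cons.injEq] at h
      obtain rfl : q = p := Prod.ext (Subtype.ext h.1) (Subtype.ext h.2.1)
      exact ⟨s, hs, h.2.2⟩
  · rintro ⟨s, hs, rfl⟩
    exact ⟨p :: s, hs, rfl⟩

theorem rightQuot_rightQuot_flattenBlocks_image (p : ↥B × ↥B') (T : Set (List (↥B × ↥B'))) :
    rightQuot p.1.1 (rightQuot p.2.1 (flattenBlocks '' T)) =
      flattenBlocks '' rightQuot p T := by
  ext w
  constructor
  · rintro ⟨s, hs, h⟩
    rcases List.eq_nil_or_concat' s with rfl | ⟨s, q, rfl⟩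
    · exact absurd h (by simp [flattenBlocks])
    · rw [flattenBlocks_concat] at h
      obtain ⟨hw₂, h2⟩ := List.append_inj' h rfl
      obtain ⟨hw, h1⟩ := List.append_inj' hw₂ rfl
      obtain rfl : q = p :=
        Prod.ext (Subtype.ext (by simpa using h1)) (Subtype.ext (by simpa using h2))
      exact ⟨s, hs, hw⟩
  · rintro ⟨s, hs, rfl⟩
    exact ⟨s ++ [p], hs, flattenBlocks_concat p s⟩

/-- The point of the full shift over `A` spelled by a sequence of blocks. -/
abbrev spell (y : ℤ → ↥B × ↥B') : ℤ → A := interleave Subtype.val Subtype.val y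

theorem spell_two_mul (y : ℤ → ↥B × ↥B') (m : ℤ) : spell y (2 * m) = (y m).1.1 := by
  simp [spell, interleave]

theorem spell_two_mul_add_one (y : ℤ → ↥B × ↥B') (m : ℤ) :
    spell y (2 * m + 1) = (y m).2.1 := by
  simp only [spell, interleave]
  rw [if_neg (by omega), show (2 * m + 1) / 2 = m by omega]

theorem spell_shiftZ (t : ℤ) (y : ℤ → ↥B × ↥B') :
    spell (shiftZ t y) = shiftZ (2 * t) (spell y) := by
  ext n
  rcases Int.even_or_odd' n with ⟨m, rfl | rfl⟩
  · rw [spell_two_mul, shiftZ, shiftZ, ← mul_add, spell_two_mul]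
  · rw [spell_two_mul_add_one, shiftZ, shiftZ, add_right_comm, ← mul_add, spell_two_mul_add_one]

theorem word_spell (y : ℤ → ↥B × ↥B') (k : ℤ) (n : ℕ) :
    word (spell y) (2 * k) (2 * n) = flattenBlocks (word y k n) := by
  induction n with
  | zero => rfl
  | succ n ih =>
    rw [Nat.mul_succ, word_succ y, flattenBlocks_concat, ← ih, ← spell_two_mul,
      ← spell_two_mul_add_one, word_succ, word_succ]
    push_cast
    rw [mul_add, add_assoc]

theorem shiftZ_mem_lambdaCD {Λ : Set (ℤ → A)} (hΛ : ∀ t, ∀ x ∈ Λ, shiftZ t x ∈ Λ)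
    (t : ℤ) (y : ℤ → ↥B × ↥B') (hy : y ∈ LambdaCD Λ B B') : shiftZ t y ∈ LambdaCD Λ B B' := by
  change spell (shiftZ t y) ∈ Λ
  rw [spell_shiftZ]
  exact hΛ _ _ hy

theorem BipartiteWith.exists_spell_eq {Λ : Set (ℤ → A)} (hbip : BipartiteWith Λ B B')
    (hdisj : Disjoint B B') {z : ℤ → A} (hz : z ∈ Λ) {m : ℤ} (hm : z (2 * m) ∈ B) :
    ∃ y : ℤ → ↥B × ↥B', spell y = z := by
  rcases hbip z hz with h | h
  · refine ⟨fun n => (⟨z (2 * n), (h _).1 (even_two_mul n)⟩,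
      ⟨z (2 * n + 1), (h _).2 (odd_two_mul_add_one n)⟩), ?_⟩
    ext n
    rcases Int.even_or_odd' n with ⟨m, rfl | rfl⟩
    · rw [spell_two_mul]
    · rw [spell_two_mul_add_one]
  · exact absurd ((h _).1 (even_two_mul m)) (Set.disjoint_left.1 hdisj hm)

theorem lang_spell {Λ : Set (ℤ → A)} (hbip : BipartiteWith Λ B B') (hdisj : Disjoint B B')
    (y : ℤ → ↥B × ↥B') (k : ℤ) (n : ℕ) :
    lang Λ (spell y) (2 * k) (2 * n) = flattenBlocks '' lang (LambdaCD Λ B B') y k n := by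
  ext w
  constructor
  · rintro ⟨z, hz, hzy, rfl⟩
    have hm : z (2 * (k + n)) ∈ B := by
      rw [hzy _ (by push_cast; omega), spell_two_mul]
      exact Subtype.property _
    obtain ⟨v, rfl⟩ := hbip.exists_spell_eq hdisj hz hm
    refine ⟨_, ⟨v, hz, fun m hm => ?_, rfl⟩, (word_spell v k n).symm⟩
    have h1 := hzy (2 * m) (by push_cast; omega)
    have h2 := hzy (2 * m + 1) (by push_cast; omega)
    rw [spell_two_mul, spell_two_mul] at h1
    rw [spell_two_mul_add_one, spell_two_mul_add_one] at h2
    exact Prod.ext (Subtype.ext h1) (Subtype.ext h2)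
  · rintro ⟨_, ⟨v, hv, hvy, rfl⟩, rfl⟩
    refine ⟨spell v, hv, fun m hm => ?_, word_spell v k n⟩
    simp only [spell, interleave]
    rw [hvy (m / 2) (by push_cast at hm; omega)]

end Blocks

section Gaps

variable {A : Type}

/-- The languages of the gaps of length `n` in points of `Λ` that are followed by a letter
of `B`. -/
def gapLangs (Λ : Set (ℤ → A)) (B : Set A) (n : ℕ) : Set (Set (List A)) :=
  {L | ∃ x ∈ Λ, ∃ k : ℤ, x (k + n) ∈ B ∧ lang Λ x k n = L}

theorem gapLangs_finite [Finite A] (Λ : Set (ℤ → A)) (B : Set A) (n : ℕ) :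
    (gapLangs Λ B n).Finite := by
  refine (List.finite_length_eq A n).finite_subsets.subset ?_
  rintro _ ⟨x, -, k, -, rfl⟩ w ⟨z, -, -, rfl⟩
  exact length_word z k n

theorem nonempty_of_mem_gapLangs {Λ : Set (ℤ → A)} {B : Set A} {n : ℕ} {L : Set (List A)}
    (hL : L ∈ gapLangs Λ B n) : L.Nonempty := by
  obtain ⟨x, hx, k, -, rfl⟩ := hL
  exact lang_nonempty hx k n

theorem leftQuot_mem_gapLangs {Λ : Set (ℤ → A)} {B : Set A} {n : ℕ} {L : Set (List A)}
    (hL : L ∈ gapLangs Λ B (n + 1)) (b : A) (h : (leftQuot b L).Nonempty) :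
    leftQuot b L ∈ gapLangs Λ B n := by
  obtain ⟨x, hx, k, hB, rfl⟩ := hL
  obtain ⟨w, z, hz, hzx, hw⟩ := h
  rw [word_succ', List.cons.injEq] at hw
  refine ⟨z, hz, k + 1, ?_, ?_⟩
  · rw [hzx _ (by push_cast; omega)]
    convert hB using 2
    push_cast
    ring
  · rw [lang_eq_leftQuot_self, hw.1, lang_eq_of_agree Λ hzx]

theorem rightQuot_mem_gapLangs {Λ : Set (ℤ → A)} {B B' : Set A} {n : ℕ} {L : Set (List A)}
    (hL : L ∈ gapLangs Λ B' (n + 1)) (a : ↥B) (h : (rightQuot a.1 L).Nonempty) :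
    rightQuot a.1 L ∈ gapLangs Λ B n := by
  obtain ⟨x, hx, k, -, rfl⟩ := hL
  obtain ⟨w, z, hz, hzx, hw⟩ := h
  rw [word_succ] at hw
  have ha : z (k + n) = a := by simpa using (List.append_inj' hw rfl).2
  refine ⟨z, hz, k, ha ▸ a.2, ?_⟩
  rw [lang_eq_rightQuot_self, ha, lang_eq_of_agree Λ hzx]

theorem Presents.exists_gapLangs_enumeration {Λ : Set (ℤ → A)} {B B' : Set A}
    (hΛ : ∀ t, ∀ x ∈ Λ, shiftZ t x ∈ Λ) (hbip : BipartiteWith Λ B B') (hdisj : Disjoint B B')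
    {M : SMBData (↥B × ↥B') (↥B × ↥B')}
    (hM : Presents M (canonicalLGBS (LambdaCD Λ B B'))) :
    ∃ K : ∀ l, Fin (M.m l) → Set (List A),
      (∀ l, Function.Injective (K l)) ∧ (∀ l, Set.range (K l) = gapLangs Λ B (2 * l)) ∧
      (∀ l i j, (M.Mm l i j).Nodup ∧ ∀ a, a ∈ M.Mm l i j ↔
        K l i = leftQuot a.2.1 (leftQuot a.1.1 (K (l + 1) j))) ∧
      (∀ l i j, (M.Mp l i j).Nodup ∧ ∀ a, a ∈ M.Mp l i j ↔
        K l i = rightQuot a.1.1 (rightQuot a.2.1 (K (l + 1) j))) := by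
  obtain ⟨e, hm, hp⟩ := hM.exists_equiv
  have hΓ := fun t y => shiftZ_mem_lambdaCD (B := B) (B' := B') hΛ t y
  have hinj := (flattenBlocks_injective (B := B) (B' := B')).image_injective
  refine ⟨fun l i => flattenBlocks '' classLang (LambdaCD Λ B B') l ((e l).symm i),
    fun l => hinj.comp ((classLang_injective l).comp (e l).symm.injective),
    fun l => ?_, fun l i j => ⟨(hm l i j).1, fun a => ?_⟩,
    fun l i j => ⟨(hp l i j).1, fun a => ?_⟩⟩
  · have hgap : ∀ y, flattenBlocks '' lang (LambdaCD Λ B B') y (1 - l) l =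
        lang Λ (spell y) (2 * (1 - l)) (2 * l) := fun y => (lang_spell hbip hdisj y _ l).symm
    ext L
    constructor
    · rintro ⟨i, rfl⟩
      obtain ⟨y, hy⟩ := Quotient.exists_rep ((e l).symm i)
      simp only [← hy, classLang_mk, hgap]
      refine ⟨spell y.1, y.2, _, ?_, rfl⟩
      rw [show (2 : ℤ) * (1 - l) + (2 * l : ℕ) = 2 * 1 by push_cast; ring, spell_two_mul]
      exact Subtype.property _
    · rintro ⟨x, hx, k, hB, rfl⟩
      have hx' := hΛ (k + (2 * l : ℕ) - 2) x hx
      obtain ⟨y, hy⟩ := hbip.exists_spell_eq hdisj hx' (m := 1) (by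
        convert hB using 1
        simp only [shiftZ]
        congr 1
        ring)
      have hyΛ : spell y ∈ Λ := hy ▸ hx'
      refine ⟨e l (Quotient.mk _ ⟨y, hyΛ⟩), ?_⟩
      · simp only [Equiv.symm_apply_apply, classLang_mk, hgap]
        rw [hy, lang_shiftZ hΛ]
        congr 1
        push_cast
        ring
  · rw [(hm l i j).2 a, leftQuot_leftQuot_flattenBlocks_image, hinj.eq_iff, ← minusRel_iff]
  · rw [(hp l i j).2 a, rightQuot_rightQuot_flattenBlocks_image, hinj.eq_iff,
      ← plusRel_iff hΓ]

end Gaps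

section SymbolicMatrices

theorem exists_enumeration_extending {X : Type} (V : ℕ → Set X) (hV : ∀ n, (V n).Finite)
    (m : ℕ → ℕ) (k : ∀ l, Fin (m l) → X) (hk : ∀ l, Function.Injective (k l))
    (hkV : ∀ l, Set.range (k l) = V (2 * l)) :
    ∃ (c : ℕ → ℕ) (K : ∀ n, Fin (c n) → X),
      (∀ n, Function.Injective (K n)) ∧ (∀ n, Set.range (K n) = V n) ∧
      ∃ hc : ∀ l, c (2 * l) = m l, ∀ l i, K (2 * l) (Fin.cast (hc l).symm i) = k l i := by
  have key : ∀ n, ∃ (c : ℕ) (K : Fin c → X), Function.Injective K ∧ Set.range K = V n ∧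
      ∀ l, n = 2 * l → ∃ h : c = m l, ∀ i, K (Fin.cast h.symm i) = k l i := by
    intro n
    rcases Nat.even_or_odd' n with ⟨l, rfl | rfl⟩
    · refine ⟨m l, k l, hk l, hkV l, fun l' h => ?_⟩
      obtain rfl : l = l' := by omega
      exact ⟨rfl, fun _ => rfl⟩
    · have := (hV (2 * l + 1)).to_subtype
      refine ⟨_, Subtype.val ∘ (Finite.equivFin (V (2 * l + 1))).symm,
        Subtype.val_injective.comp (Equiv.injective _), ?_, fun l' h => by omega⟩
      rw [(Finite.equivFin _).symm.surjective.range_comp, Subtype.range_val]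
  choose c K hinj hrange hK using key
  exact ⟨c, K, hinj, hrange, fun l => (hK _ l rfl).1, fun l => (hK _ l rfl).2⟩

variable {X I J H S T : Type}

open Classical in
/-- The symbolic matrix with an edge `i → j` labeled `t` iff `f i = op t (g j)`. -/
noncomputable def opMatrix [Fintype T] (op : T → X → X) (f : I → X) (g : J → X) (i : I) (j : J) :
    Multiset T :=
  (Finset.univ.filter fun t => f i = op t (g j)).val

variable [Fintype S] [Fintype T]

theorem mem_opMatrix {op : T → X → X} {f : I → X} {g : J → X} {i : I} {j : J} {t : T} :
    t ∈ opMatrix op f g i j ↔ f i = op t (g j) := by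
  simp [opMatrix]

theorem nodup_opMatrix (op : T → X → X) (f : I → X) (g : J → X) (i : I) (j : J) :
    (opMatrix op f g i j).Nodup :=
  Finset.nodup _

theorem symMul_opMatrix [Fintype J] (op₁ : S → Set X → Set X) (op₂ : T → Set X → Set X)
    (f : I → Set X) (g : J → Set X) (h : H → Set X) (hg : Function.Injective g)
    (hop : ∀ s, op₁ s ∅ = ∅) (hf : ∀ i, (f i).Nonempty)
    (hgh : ∀ t k, (op₂ t (h k)).Nonempty → op₂ t (h k) ∈ Set.range g) :
    symMul (opMatrix op₁ f g) (opMatrix op₂ g h) =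
      opMatrix (fun p : S × T => op₁ p.1 ∘ op₂ p.2) f h := by
  funext i k
  have hsum : symMul (opMatrix op₁ f g) (opMatrix op₂ g h) i k =
      (Finset.univ : Finset J).val.bind fun j =>
        opMatrix op₁ f g i j ×ˢ opMatrix op₂ g h j k := rfl
  rw [hsum]
  refine (Multiset.Nodup.ext ?_ (nodup_opMatrix _ _ _ _ _)).2 fun p => ?_
  · refine Multiset.nodup_bind.2
      ⟨fun j _ => (nodup_opMatrix _ _ _ _ _).product (nodup_opMatrix _ _ _ _ _), ?_⟩
    refine Multiset.Nodup.pairwise (fun j _ j' _ hjj' => ?_) Finset.univ.nodup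
    refine Multiset.disjoint_left.2 fun {p} hp hp' => hjj' (hg ?_)
    rw [Multiset.mem_product, mem_opMatrix, mem_opMatrix] at hp hp'
    rw [hp.2, hp'.2]
  · simp only [Multiset.mem_bind, Multiset.mem_product, mem_opMatrix, Function.comp]
    constructor
    · rintro ⟨j, -, h1, h2⟩
      rw [h1, h2]
    · intro hp
      have hne : (op₂ p.2 (h k)).Nonempty := by
        rw [Set.nonempty_iff_ne_empty]
        intro he
        rw [he, hop] at hp
        exact (hf i).ne_empty hp
      obtain ⟨j, hj⟩ := hgh _ _ hne
      exact ⟨j, Finset.mem_univ j, by rw [hj, hp], hj⟩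

theorem map_eq_opMatrix {U : Type} {s : Multiset U} (hs : s.Nodup) (σ : U ≃ T)
    {op : T → X → X} {f : I → X} {g : J → X} {i : I} {j : J}
    (hmem : ∀ u, u ∈ s ↔ f i = op (σ u) (g j)) :
    s.map σ = opMatrix op f g i j := by
  refine (Multiset.Nodup.ext (hs.map σ.injective) (nodup_opMatrix _ _ _ _ _)).2 fun t => ?_
  rw [mem_opMatrix, Multiset.mem_map]
  constructor
  · rintro ⟨u, hu, rfl⟩
    exact (hmem u).1 hu
  · intro h
    exact ⟨σ.symm t, (hmem _).2 (by rwa [σ.apply_symm_apply]), σ.apply_symm_apply t⟩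

theorem map_swap_opMatrix (op₁ : S → X → X) (op₂ : T → X → X)
    (hcomm : ∀ s t x, op₁ s (op₂ t x) = op₂ t (op₁ s x)) (f : I → X) (g : J → X)
    (i : I) (j : J) :
    (opMatrix (fun p : S × T => op₁ p.1 ∘ op₂ p.2) f g i j).map Prod.swap =
      opMatrix (fun p : T × S => op₂ p.1 ∘ op₁ p.2) f g i j :=
  map_eq_opMatrix (nodup_opMatrix _ _ _ _ _) (Equiv.prodComm S T) fun p => by
    rw [mem_opMatrix]
    simp only [Function.comp, hcomm]
    rfl

end SymbolicMatrices

/-- for a nonempty bipartite subshift `Λ` with respect to disjoint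
alphabets `C, D`, the canonical symbolic matrix bisystems of `Λ_{CD}` and `Λ_{DC}`
are properly strong shift equivalent in 1-step. -/
theorem stmt_10 {A : Type} [Finite A] [TopologicalSpace A] [DiscreteTopology A]
    (Λ : Set (ℤ → A)) (hΛ : IsSubshift Λ) (hne : Λ.Nonempty)
    (C D : Set A) (hdisj : Disjoint C D) (hcover : C ∪ D = Set.univ)
    (hbip : BipartiteWith Λ C D)
    (M : SMBData (↥C × ↥D) (↥C × ↥D)) (N : SMBData (↥D × ↥C) (↥D × ↥C))
    (hM : Presents M (canonicalLGBS (LambdaCD Λ C D)))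
    (hN : Presents N (canonicalLGBS (LambdaDC Λ C D))) :
    ∃ C' D' : Type, Nonempty (PSSE1Data C' D' M N) := by
  have hshift := shiftZ_mem_of_shiftMap_image_eq hΛ.2
  obtain ⟨k, hk, hkV, hkm, hkp⟩ := hM.exists_gapLangs_enumeration hshift hbip hdisj
  have hN' : Presents N (canonicalLGBS (LambdaCD Λ D C)) := hN
  obtain ⟨k', hk', hkV', hkm', hkp'⟩ :=
    hN'.exists_gapLangs_enumeration hshift (fun x hx => (hbip x hx).symm) hdisj.symm
  obtain ⟨c, K, hK, hKV, hc, hKk⟩ :=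
    exists_enumeration_extending _ (gapLangs_finite Λ C) _ k hk hkV
  obtain ⟨d, K', hK', hKV', hd, hKk'⟩ :=
    exists_enumeration_extending _ (gapLangs_finite Λ D) _ k' hk' hkV'
  have mem : ∀ n i, K n i ∈ gapLangs Λ C n := fun n i => hKV n ▸ Set.mem_range_self i
  have mem' : ∀ n i, K' n i ∈ gapLangs Λ D n := fun n i => hKV' n ▸ Set.mem_range_self i
  have nonempty : ∀ n i, (K n i).Nonempty := fun n i => nonempty_of_mem_gapLangs (mem n i)
  have nonempty' : ∀ n i, (K' n i).Nonempty := fun n i => nonempty_of_mem_gapLangs (mem' n i)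
  have := Fintype.ofFinite ↥C
  have := Fintype.ofFinite ↥D
  let lC : ↥C → Set (List A) → Set (List A) := fun a => leftQuot a.1
  let lD : ↥D → Set (List A) → Set (List A) := fun a => leftQuot a.1
  let rC : ↥C → Set (List A) → Set (List A) := fun a => rightQuot a.1
  let rD : ↥D → Set (List A) → Set (List A) := fun a => rightQuot a.1
  have lC_range : ∀ n (a : ↥C) i, (lC a (K (n + 1) i)).Nonempty →
      lC a (K (n + 1) i) ∈ Set.range (K n) :=
    fun n a i h => hKV n ▸ leftQuot_mem_gapLangs (mem _ i) a.1 h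
  have lD_range : ∀ n (a : ↥D) i, (lD a (K (n + 1) i)).Nonempty →
      lD a (K (n + 1) i) ∈ Set.range (K n) :=
    fun n a i h => hKV n ▸ leftQuot_mem_gapLangs (mem _ i) a.1 h
  have lC_range' : ∀ n (a : ↥C) i, (lC a (K' (n + 1) i)).Nonempty →
      lC a (K' (n + 1) i) ∈ Set.range (K' n) :=
    fun n a i h => hKV' n ▸ leftQuot_mem_gapLangs (mem' _ i) a.1 h
  have lD_range' : ∀ n (a : ↥D) i, (lD a (K' (n + 1) i)).Nonempty →
      lD a (K' (n + 1) i) ∈ Set.range (K' n) :=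
    fun n a i h => hKV' n ▸ leftQuot_mem_gapLangs (mem' _ i) a.1 h
  have rC_range : ∀ n (a : ↥C) i, (rC a (K' (n + 1) i)).Nonempty →
      rC a (K' (n + 1) i) ∈ Set.range (K n) :=
    fun n a i h => hKV n ▸ rightQuot_mem_gapLangs (mem' _ i) a h
  have rD_range : ∀ n (a : ↥D) i, (rD a (K (n + 1) i)).Nonempty →
      rD a (K (n + 1) i) ∈ Set.range (K' n) :=
    fun n a i h => hKV' n ▸ rightQuot_mem_gapLangs (mem _ i) a h
  refine ⟨↥C, ↥D, ⟨{
    φ := id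
    ψ := id
    φ_inj := Function.injective_id
    ψ_inj := Function.injective_id
    c := c
    d := d
    hc := hc
    hd := hd
    P := fun l => opMatrix rC (K l) (K' (l + 1))
    Q := fun l => opMatrix rD (K' l) (K (l + 1))
    Xe := fun l => opMatrix lD (K (2 * l)) (K (2 * l + 1))
    Xo := fun l => opMatrix lD (K' (2 * l + 1)) (K' (2 * l + 2))
    Ye := fun l => opMatrix lC (K' (2 * l)) (K' (2 * l + 1))
    Yo := fun l => opMatrix lC (K (2 * l + 1)) (K (2 * l + 2))
    hMp := fun l i j => ?_
    hNp := fun l i j => ?_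
    hMm := fun l i j => ?_
    hNm := fun l i j => ?_
    hYP := fun l i j => ?_
    hXQ := fun l i j => ?_
    hXP := fun l i j => ?_
    hYQ := fun l i j => ?_ }⟩⟩
  · rw [symMul_opMatrix _ _ _ _ _ (hK' _) (fun _ => rightQuot_empty _) (nonempty _) (rD_range _)]
    refine map_eq_opMatrix (hkp l i j).1 (Equiv.refl _) fun a => ?_
    rw [(hkp l i j).2 a, ← hKk l i, ← hKk (l + 1) j]
    rfl
  · rw [symMul_opMatrix _ _ _ _ _ (hK _) (fun _ => rightQuot_empty _) (nonempty' _) (rC_range _)]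
    refine map_eq_opMatrix (hkp' l i j).1 (Equiv.refl _) fun a => ?_
    rw [(hkp' l i j).2 a, ← hKk' l i, ← hKk' (l + 1) j]
    rfl
  · rw [symMul_opMatrix _ _ _ _ _ (hK _) (fun _ => leftQuot_empty _) (nonempty _) (lC_range _)]
    refine map_eq_opMatrix (hkm l i j).1 (Equiv.prodComm _ _) fun a => ?_
    rw [(hkm l i j).2 a, ← hKk l i, ← hKk (l + 1) j]
    rfl
  · rw [symMul_opMatrix _ _ _ _ _ (hK' _) (fun _ => leftQuot_empty _) (nonempty' _) (lD_range' _)]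
    refine map_eq_opMatrix (hkm' l i j).1 (Equiv.prodComm _ _) fun a => ?_
    rw [(hkm' l i j).2 a, ← hKk' l i, ← hKk' (l + 1) j]
    rfl
  · rw [symMul_opMatrix _ _ _ _ _ (hK _) (fun _ => leftQuot_empty _) (nonempty _) (rC_range _),
      map_swap_opMatrix lC rC (fun _ _ _ => leftQuot_rightQuot _ _ _)]
    exact congrFun₂ (symMul_opMatrix _ _ _ _ _ (hK' _) (fun _ => rightQuot_empty _)
      (nonempty _) (lC_range' _)).symm i j
  · rw [symMul_opMatrix _ _ _ _ _ (hK' _) (fun _ => leftQuot_empty _) (nonempty' _) (rD_range _),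
      map_swap_opMatrix lD rD (fun _ _ _ => leftQuot_rightQuot _ _ _)]
    exact congrFun₂ (symMul_opMatrix _ _ _ _ _ (hK _) (fun _ => rightQuot_empty _)
      (nonempty' _) (lD_range _)).symm i j
  · rw [symMul_opMatrix _ _ _ _ _ (hK _) (fun _ => leftQuot_empty _) (nonempty _) (rC_range _),
      map_swap_opMatrix lD rC (fun _ _ _ => leftQuot_rightQuot _ _ _)]
    exact congrFun₂ (symMul_opMatrix _ _ _ _ _ (hK' _) (fun _ => rightQuot_empty _)
      (nonempty _) (lD_range' _)).symm i j
  · rw [symMul_opMatrix _ _ _ _ _ (hK' _) (fun _ => leftQuot_empty _) (nonempty' _) (rD_range _),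
      map_swap_opMatrix lC rD (fun _ _ _ => leftQuot_rightQuot _ _ _)]
    exact congrFun₂ (symMul_opMatrix _ _ _ _ _ (hK _) (fun _ => rightQuot_empty _)
      (nonempty' _) (lC_range _)).symm i j
end

section
/- For symbolic matrix bisystems satisfying FPCC, properly strong shift equivalence in 1-step implies strong shift equivalence in 1-step. Explicitly, if P_l, Q_l, X_l, Y_l witness a properly strong shift equivalence in 1-step between (M⁻,M⁺) and (N⁻,N⁺), then the matrices H_l = X_{2l}P_{2l+1} and K_l = Y_{2l}Q_{2l+1} witness a strong shift equivalence in 1-step between them. -/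
/-- The data of a strong shift equivalence in 1-step between two symbolic matrix
bisystems `M` and `N`: alphabets `C, D`, specifications
`φ₁ : Σ_M⁻·Σ_M⁺ → C·D`, `φ₂ : Σ_N⁻·Σ_N⁺ → D·C`, `φ_C^± : Σ_M^±·C → C·Σ_N^±`,
`φ_D^± : Σ_N^±·D → D·Σ_M^±`, and matrices `H_l` over `C`, `K_l` over `D` subject to
the defining specified equivalences. -/
structure SSE1Data (C D : Type) {SM SN : Type} (M : SMBData SM SM) (N : SMBData SN SN) where
  φ₁ : SM × SM → C × D
  φ₂ : SN × SN → D × C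
  φCp : SM × C → C × SN
  φCm : SM × C → C × SN
  φDp : SN × D → D × SM
  φDm : SN × D → D × SM
  H : ∀ l, Fin (M.m l) → Fin (N.m (l + 1)) → Multiset C
  K : ∀ l, Fin (N.m l) → Fin (M.m (l + 1)) → Multiset D
  hM : ∀ l i j, (symMul (M.Mm l) (M.Mp (l + 1)) i j).map φ₁ = symMul (H l) (K (l + 1)) i j
  hN : ∀ l i j, (symMul (N.Mm l) (N.Mp (l + 1)) i j).map φ₂ = symMul (K l) (H (l + 1)) i j
  hCp : ∀ l i j, (symMul (M.Mp l) (H (l + 1)) i j).map φCp = symMul (H l) (N.Mp (l + 1)) i j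
  hDp : ∀ l i j, (symMul (N.Mp l) (K (l + 1)) i j).map φDp = symMul (K l) (M.Mp (l + 1)) i j
  hCm : ∀ l i j, (symMul (M.Mm l) (H (l + 1)) i j).map φCm = symMul (H l) (N.Mm (l + 1)) i j
  hDm : ∀ l i j, (symMul (N.Mm l) (K (l + 1)) i j).map φDm = symMul (K l) (M.Mm (l + 1)) i j

theorem finsetSum_bind {ι α β : Type} (s : Finset ι) (m : ι → Multiset α)
    (f : α → Multiset β) : (∑ j ∈ s, m j).bind f = ∑ j ∈ s, (m j).bind f := by
  classical
  induction s using Finset.induction_on with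
  | empty => simp
  | insert a s ha ih => simp [Finset.sum_insert ha, Multiset.add_bind, ih]

theorem bind_finsetSum {ι α β : Type} (s : Finset ι) (m : Multiset α)
    (f : ι → α → Multiset β) :
    (m.bind fun a => ∑ j ∈ s, f j a) = ∑ j ∈ s, m.bind (f j) := by
  classical
  induction s using Finset.induction_on with
  | empty => simp
  | insert a s ha ih => simp [Finset.sum_insert ha, Multiset.bind_add, ih]

theorem multiset_map_finsetSum {ι α β : Type} (s : Finset ι) (m : ι → Multiset α) (f : α → β) :
    (∑ j ∈ s, m j).map f = ∑ j ∈ s, (m j).map f :=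
  map_sum (Multiset.mapAddMonoidHom f) m s

theorem symMul_map {I J K C D C' D' : Type} [Fintype J]
    (A : I → J → Multiset C) (B : J → K → Multiset D) (f : C → C') (g : D → D') (i : I) (k : K) :
    (symMul A B i k).map (Prod.map f g) =
      symMul (fun i j => (A i j).map f) (fun j k => (B j k).map g) i k := by
  simp [symMul, multiset_map_finsetSum, Multiset.map_bind, Multiset.bind_map, Multiset.map_map]

theorem symMul_reindex {I J J' K C D : Type} [Fintype J] [Fintype J'] (e : J' ≃ J)
    (A : I → J → Multiset C) (B : J → K → Multiset D) (i : I) (k : K) :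
    symMul (fun i j => A i (e j)) (fun j k => B (e j) k) i k = symMul A B i k :=
  Equiv.sum_comp e fun j => (A i j).bind fun a => (B j k).map fun b => (a, b)

theorem symMul_assoc {I J K L C D E : Type} [Fintype J] [Fintype K]
    (A : I → J → Multiset C) (B : J → K → Multiset D) (F : K → L → Multiset E) (i : I) (l : L) :
    (symMul (symMul A B) F i l).map (Equiv.prodAssoc C D E) =
      symMul A (symMul B F) i l := by
  simp only [symMul, multiset_map_finsetSum, finsetSum_bind, bind_finsetSum, Multiset.map_bind,
    Multiset.bind_map, Multiset.map_map, Multiset.bind_assoc, Function.comp_def,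
    Equiv.prodAssoc_apply]
  exact Finset.sum_comm

theorem symMul_assoc_symm {I J K L C D E : Type} [Fintype J] [Fintype K]
    (A : I → J → Multiset C) (B : J → K → Multiset D) (F : K → L → Multiset E) (i : I) (l : L) :
    (symMul A (symMul B F) i l).map (Equiv.prodAssoc C D E).symm =
      symMul (symMul A B) F i l := by
  simp [← symMul_assoc, Multiset.map_map]

/-- Exchanging the two middle factors of a fourfold product of symbolic matrices. -/
theorem symMul_exchange_middle {I J K K' L R C₁ C₂ C₃ C₄ : Type}
    [Fintype J] [Fintype K] [Fintype K'] [Fintype L]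
    (X : I → J → Multiset C₁) (Y : J → K → Multiset C₂)
    (P : K → L → Multiset C₃) (Q : L → R → Multiset C₄)
    (P' : J → K' → Multiset C₃) (Y' : K' → L → Multiset C₂)
    (h : ∀ j l, (symMul Y P j l).map Prod.swap = symMul P' Y' j l) (i : I) (r : R) :
    (symMul (symMul X Y) (symMul P Q) i r).map (Equiv.prodProdProdComm C₁ C₂ C₃ C₄) =
      symMul (symMul X P') (symMul Y' Q) i r := by
  have h' : (fun j l => (symMul Y P j l).map Prod.swap) = symMul P' Y' := by
    funext j l; exact h j l
  have inner : (fun j r => (symMul Y (symMul P Q) j r).map fun w =>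
      (w.2.1, w.1, w.2.2)) = symMul P' (symMul Y' Q) := by
    funext j r
    rw [← symMul_assoc P' Y' Q, ← h', ← symMul_assoc Y P Q]
    have := symMul_map (symMul Y P) Q Prod.swap id j r
    simp only [Multiset.map_id] at this
    rw [← this, Multiset.map_map, Multiset.map_map]
    rfl
  have outer := symMul_map X (symMul Y (symMul P Q)) id (fun w => (w.2.1, w.1, w.2.2)) i r
  simp only [Multiset.map_id] at outer
  rw [inner] at outer
  rw [← symMul_assoc_symm X P', ← outer, ← symMul_assoc X Y, Multiset.map_map, Multiset.map_map]
  rfl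

theorem symMul_exchange_left {I J J' K L C₁ C₂ E : Type}
    [Fintype J] [Fintype J'] [Fintype K]
    (X : I → J → Multiset C₁) (Y : J → K → Multiset C₂) (F : K → L → Multiset E)
    (Y' : I → J' → Multiset C₂) (X' : J' → K → Multiset C₁)
    (h : ∀ i k, (symMul X Y i k).map Prod.swap = symMul Y' X' i k) (i : I) (l : L) :
    (symMul (symMul X Y) F i l).map (Prod.map Prod.swap id) = symMul (symMul Y' X') F i l := by
  simp only [symMul_map, h, Multiset.map_id]

theorem symMul_exchange_right {I J K K' L C₁ C₂ E : Type}
    [Fintype J] [Fintype K] [Fintype K']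
    (F : I → J → Multiset E) (X : J → K → Multiset C₁) (Y : K → L → Multiset C₂)
    (Y' : J → K' → Multiset C₂) (X' : K' → L → Multiset C₁)
    (h : ∀ j l, (symMul X Y j l).map Prod.swap = symMul Y' X' j l) (i : I) (l : L) :
    (symMul F (symMul X Y) i l).map (Prod.map id Prod.swap) = symMul F (symMul Y' X') i l := by
  simp only [symMul_map, h, Multiset.map_id]

theorem map_swap_eq_comm {α β : Type} {s : Multiset (α × β)} {t : Multiset (β × α)}
    (h : s.map Prod.swap = t) : t.map Prod.swap = s := by
  simp [← h, Multiset.map_map]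

theorem IsSMB.nonempty_alphabet {Sm Sp : Type} {M : SMBData Sm Sp} (h : IsSMB M) :
    Nonempty Sp := by
  obtain ⟨j, hj⟩ := h.row_p 0 ⟨0, h.mpos 0⟩
  obtain ⟨a, -⟩ := Multiset.exists_mem_of_ne_zero hj
  exact ⟨a⟩

namespace PSSE1Data

variable {A B C D : Type} {M : SMBData A A} {N : SMBData B B}

/-- Exchanging the roles of `M` and `N` in a properly strong shift equivalence. -/
def symm (pd : PSSE1Data C D M N) : PSSE1Data D C N M where
  φ := pd.ψ
  ψ := pd.φ
  φ_inj := pd.ψ_inj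
  ψ_inj := pd.φ_inj
  c := pd.d
  d := pd.c
  hc := pd.hd
  hd := pd.hc
  P := pd.Q
  Q := pd.P
  Xe := pd.Ye
  Xo := pd.Yo
  Ye := pd.Xe
  Yo := pd.Xo
  hMp := pd.hNp
  hNp := pd.hMp
  hMm := pd.hNm
  hNm := pd.hMm
  hYP := pd.hXQ
  hXQ := pd.hYP
  hXP := pd.hYQ
  hYQ := pd.hXP

/-- The matrices `H_l = X_{2l} P_{2l+1}`. -/
def H (pd : PSSE1Data C D M N) (l : ℕ) (i : Fin (M.m l)) (j : Fin (N.m (l + 1))) :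
    Multiset (D × C) :=
  symMul (pd.Xe l) (pd.P (2 * l + 1))
    (Fin.cast (pd.hc l).symm i) (Fin.cast (pd.hd (l + 1)).symm j)

theorem map_Mm_mul_Mp (pd : PSSE1Data C D M N) (l : ℕ) (i : Fin (M.m l))
    (j : Fin (M.m (l + 2))) :
    (symMul (M.Mm l) (M.Mp (l + 1)) i j).map
        (Equiv.prodProdProdComm D C C D ∘ Prod.map (Prod.swap ∘ pd.φ) pd.φ) =
      symMul (pd.H l) (pd.symm.H (l + 1)) i j := by
  rw [← Multiset.map_map, symMul_map]
  simp only [pd.hMm, pd.hMp]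
  refine Eq.trans (congrArg _ (symMul_reindex (finCongr (pd.hc (l + 1)).symm)
    (symMul (pd.Xe l) (pd.Yo l)) (symMul (pd.P (2 * (l + 1))) (pd.Q (2 * (l + 1) + 1)))
    (Fin.cast (pd.hc l).symm i) (Fin.cast (pd.hc (l + 2)).symm j))) ?_
  refine Eq.trans (symMul_exchange_middle _ _ _ _ _ _ (pd.hYP l) _ _) ?_
  exact (symMul_reindex (finCongr (pd.hd (l + 1)).symm) _ _ _ _).symm

theorem map_Mp_mul_H (pd : PSSE1Data C D M N) (l : ℕ) (i : Fin (M.m l))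
    (j : Fin (N.m (l + 2))) :
    (symMul (M.Mp l) (pd.H (l + 1)) i j).map
        (Prod.map Prod.swap id ∘ Equiv.prodProdProdComm C D D C ∘ Prod.map pd.φ id) =
      (symMul (pd.H l) (N.Mp (l + 1)) i j).map (Prod.map id pd.ψ) := by
  rw [← Multiset.map_map, ← Multiset.map_map, symMul_map, symMul_map]
  simp only [pd.hMp, pd.hNp, Multiset.map_id]
  refine Eq.trans (congrArg (fun s => Multiset.map _ (Multiset.map _ s))
    (symMul_reindex (finCongr (pd.hc (l + 1)).symm)
    (symMul (pd.P (2 * l)) (pd.Q (2 * l + 1)))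
    (symMul (pd.Xe (l + 1)) (pd.P (2 * (l + 1) + 1)))
    (Fin.cast (pd.hc l).symm i) (Fin.cast (pd.hd (l + 2)).symm j))) ?_
  refine Eq.trans (congrArg _ (symMul_exchange_middle _ _ _ _ _ _
    (fun i j => map_swap_eq_comm (pd.hXQ l i j)) _ _)) ?_
  refine Eq.trans (symMul_exchange_left _ _ _ _ _
    (fun i j => map_swap_eq_comm (pd.hXP l i j)) _ _) ?_
  exact (symMul_reindex (finCongr (pd.hd (l + 1)).symm) _ _ _ _).symm

theorem map_Mm_mul_H (pd : PSSE1Data C D M N) (l : ℕ) (i : Fin (M.m l))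
    (j : Fin (N.m (l + 2))) :
    (symMul (M.Mm l) (pd.H (l + 1)) i j).map
        (Equiv.prodProdProdComm D C C D ∘ Prod.map id Prod.swap ∘
          Prod.map (Prod.swap ∘ pd.φ) id) =
      (symMul (pd.H l) (N.Mm (l + 1)) i j).map (Prod.map id (Prod.swap ∘ pd.ψ)) := by
  rw [← Multiset.map_map, ← Multiset.map_map, symMul_map (M.Mm l), symMul_map (pd.H l)]
  simp only [pd.hMm, pd.hNm, Multiset.map_id]
  refine Eq.trans (congrArg (fun s => Multiset.map _ (Multiset.map _ s))
    (symMul_reindex (finCongr (pd.hc (l + 1)).symm)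
    (symMul (pd.Xe l) (pd.Yo l))
    (symMul (pd.Xe (l + 1)) (pd.P (2 * (l + 1) + 1)))
    (Fin.cast (pd.hc l).symm i) (Fin.cast (pd.hd (l + 2)).symm j))) ?_
  refine Eq.trans (congrArg _ (symMul_exchange_right _ _ _ _ _ (pd.hXP (l + 1)) _ _)) ?_
  refine Eq.trans (symMul_exchange_middle _ _ _ _ _ _ (pd.hYP l) _ _) ?_
  exact (symMul_reindex (finCongr (pd.hd (l + 1)).symm) _ _ _ _).symm

theorem exists_spec_Mp (pd : PSSE1Data C D M N) [Nonempty B] :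
    ∃ f : A × (D × C) → (D × C) × B, ∀ l i j,
      (symMul (M.Mp l) (pd.H (l + 1)) i j).map f = symMul (pd.H l) (N.Mp (l + 1)) i j := by
  refine ⟨Prod.map id (Function.invFun pd.ψ) ∘ Prod.map Prod.swap id ∘
    Equiv.prodProdProdComm C D D C ∘ Prod.map pd.φ id, fun l i j => ?_⟩
  rw [← Multiset.map_map, pd.map_Mp_mul_H, Multiset.map_map, Prod.map_comp_map,
    Function.invFun_comp pd.ψ_inj]
  simp

theorem exists_spec_Mm (pd : PSSE1Data C D M N) [Nonempty B] :
    ∃ f : A × (D × C) → (D × C) × B, ∀ l i j,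
      (symMul (M.Mm l) (pd.H (l + 1)) i j).map f = symMul (pd.H l) (N.Mm (l + 1)) i j := by
  refine ⟨Prod.map id (Function.invFun (Prod.swap ∘ pd.ψ)) ∘
    Equiv.prodProdProdComm D C C D ∘ Prod.map id Prod.swap ∘
      Prod.map (Prod.swap ∘ pd.φ) id, fun l i j => ?_⟩
  rw [← Multiset.map_map, pd.map_Mm_mul_H, Multiset.map_map, Prod.map_comp_map,
    Function.invFun_comp (Prod.swap_injective.comp pd.ψ_inj)]
  simp

end PSSE1Data

/-- for symbolic matrix bisystems satisfying FPCC, properly strong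
shift equivalence in 1-step implies strong shift equivalence in 1-step; explicitly,
if `P_l, Q_l, X_l, Y_l` witness the former, then `H_l = X_{2l}P_{2l+1}` and
`K_l = Y_{2l}Q_{2l+1}` witness the latter. -/
theorem stmt_14 {A B C D : Type} (M : SMBData A A) (N : SMBData B B)
    (hMs : IsSMB M) (hMf : M.FPCC) (hNs : IsSMB N) (hNf : N.FPCC)
    (pd : PSSE1Data C D M N) :
    ∃ sd : SSE1Data (D × C) (C × D) M N,
      (∀ l i j, sd.H l i j =
        symMul (pd.Xe l) (pd.P (2 * l + 1))
          (Fin.cast (pd.hc l).symm i) (Fin.cast (pd.hd (l + 1)).symm j)) ∧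
      (∀ l i j, sd.K l i j =
        symMul (pd.Ye l) (pd.Q (2 * l + 1))
          (Fin.cast (pd.hd l).symm i) (Fin.cast (pd.hc (l + 1)).symm j)) := by
  have := hMs.nonempty_alphabet
  have := hNs.nonempty_alphabet
  obtain ⟨fCp, hCp⟩ := pd.exists_spec_Mp
  obtain ⟨fCm, hCm⟩ := pd.exists_spec_Mm
  obtain ⟨fDp, hDp⟩ := pd.symm.exists_spec_Mp
  obtain ⟨fDm, hDm⟩ := pd.symm.exists_spec_Mm
  exact ⟨{
    φ₁ := _
    φ₂ := _
    φCp := fCp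
    φCm := fCm
    φDp := fDp
    φDm := fDm
    H := pd.H
    K := pd.symm.H
    hM := pd.map_Mm_mul_Mp
    hN := pd.symm.map_Mm_mul_Mp
    hCp := hCp
    hDp := hDp
    hCm := hCm
    hDm := hDm }, fun _ _ _ => rfl, fun _ _ _ => rfl⟩
end

section
/- Let A = [α_{ij}]_{i,j=1}^N be an N×N symbolic matrix over Σ = {α_{ij}} whose symbols α_{ij} (1 ≤ i,j ≤ N) are pairwise distinct. Define M⁻_{0,1} and M⁺_{0,1} to be the 1×N² row vectors (α⁻_{11},…,α⁻_{1N}, α⁻_{21},…,α⁻_{2N}, …, α⁻_{N1},…,α⁻_{NN}) and (α⁺_{11},…,α⁺_{NN}) respectively, and M⁻_{l,l+1} = M_A⁻, M⁺_{l,l+1} = M_A⁺ for all l ≥ 1. Then the pair (M⁻_{l,l+1}, M⁺_{l,l+1})_{l≥0} is a standard symbolic matrix bisystem over Σ⁻, Σ⁺; moreover, if the symbols α⁻_{ij} are identified with α⁺_{ij} (so Σ⁻ = Σ⁺ = Σ), it satisfies FPCC. -/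
/-- The `(i,j)`-th `N × N` block of the `N² × N²` symbolic matrix `M_A⁻` is the
scalar matrix `α⁻_{ji} I_N` (indices of `Fin N × Fin N` are (block, inner)). -/
def MAm {S : Type} {N : ℕ} (am : Fin N → Fin N → S) :
    Fin N × Fin N → Fin N × Fin N → Multiset S :=
  fun r c => if r.2 = c.2 then {am c.1 r.1} else 0

/-- The `N² × N²` symbolic matrix `M_A⁺` is block diagonal with every diagonal block
equal to `A⁺ = [α⁺_{ij}]`. -/
def MAp {T : Type} {N : ℕ} (ap : Fin N → Fin N → T) :
    Fin N × Fin N → Fin N × Fin N → Multiset T :=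
  fun r c => if r.1 = c.1 then {ap r.2 c.2} else 0

/-- Row-major decoding of an index of `Fin (N * N)` into a pair. -/
def dec (N : ℕ) (hN : 0 < N) (k : Fin (N * N)) : Fin N × Fin N :=
  (⟨k.1 / N, Nat.div_lt_of_lt_mul k.2⟩, ⟨k.1 % N, Nat.mod_lt _ hN⟩)

/-- The sizes of the standard symbolic matrix bisystem built from an `N × N`
symbolic matrix: `m 0 = 1` and `m l = N²` for `l ≥ 1`. -/
def msize (N : ℕ) : ℕ → ℕ
  | 0 => 1
  | _ + 1 => N * N

/-- The standard symbolic matrix bisystem associated to an `N × N` symbolic matrix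
`A = [α_{ij}]`: `M⁻_{0,1}` and `M⁺_{0,1}` are the row vectors listing the symbols
`α⁻_{ij}`, `α⁺_{ij}` in row-major order, and `M⁻_{l,l+1} = M_A⁻`,
`M⁺_{l,l+1} = M_A⁺` for `l ≥ 1`. -/
def smbOfSymMatrix {S T : Type} {N : ℕ} (hN : 0 < N)
    (am : Fin N → Fin N → S) (ap : Fin N → Fin N → T) : SMBData S T where
  m := msize N
  Mm := fun l => match l with
    | 0 => fun _ c => {am (dec N hN c).1 (dec N hN c).2}
    | _ + 1 => fun r c => MAm am (dec N hN r) (dec N hN c)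
  Mp := fun l => match l with
    | 0 => fun _ c => {ap (dec N hN c).1 (dec N hN c).2}
    | _ + 1 => fun r c => MAp ap (dec N hN r) (dec N hN c)

theorem dec_bijective {N : ℕ} (hN : 0 < N) : Function.Bijective (dec N hN) :=
  finProdFinEquiv.symm.bijective

theorem sum_dec {N : ℕ} (hN : 0 < N) {M : Type*} [AddCommMonoid M]
    (f : Fin N × Fin N → M) : ∑ k, f (dec N hN k) = ∑ x, ∑ y, f (x, y) := by
  rw [← Fintype.sum_prod_type]
  exact Equiv.sum_comp finProdFinEquiv.symm f

theorem symMul_dec {I K C D : Type} {N : ℕ} (hN : 0 < N)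
    (A : I → Fin N × Fin N → Multiset C) (B : Fin N × Fin N → K → Multiset D) (i : I) (k : K) :
    symMul (fun i j => A i (dec N hN j)) (fun j k => B (dec N hN j) k) i k =
      ∑ x, ∑ y, (A i (x, y)).bind fun a => (B (x, y) k).map fun b => (a, b) :=
  sum_dec hN fun p => (A i p).bind fun a => (B p k).map fun b => (a, b)

theorem ite_singleton_bind_map {C D : Type} (p q : Prop) [Decidable p] [Decidable q]
    (c : C) (d : D) :
    ((if p then {c} else 0 : Multiset C).bind fun a =>
      (if q then {d} else 0 : Multiset D).map fun b => (a, b)) =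
      if p then if q then {(c, d)} else 0 else 0 := by
  split_ifs <;> simp

section SymMul

variable {S T : Type} {N : ℕ} (hN : 0 < N) (am : Fin N → Fin N → S) (ap : Fin N → Fin N → T)

theorem symMul_MAm_MAp (i j : Fin N × Fin N) :
    symMul (fun r c => MAm am r (dec N hN c)) (fun r c => MAp ap (dec N hN r) c) i j =
      {(am j.1 i.1, ap i.2 j.2)} := by
  rw [symMul_dec]
  simp [MAm, MAp, ite_singleton_bind_map]

theorem symMul_MAp_MAm (i j : Fin N × Fin N) :
    symMul (fun r c => MAp ap r (dec N hN c)) (fun r c => MAm am (dec N hN r) c) i j =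
      {(ap i.2 j.2, am j.1 i.1)} := by
  rw [symMul_dec]
  simp [MAm, MAp, ite_singleton_bind_map]

theorem symMul_row_MAp {I : Type} (i : I) (j : Fin N × Fin N) :
    symMul (fun (_ : I) c => {am (dec N hN c).1 (dec N hN c).2})
      (fun r c => MAp ap (dec N hN r) c) i j = ∑ x, {(am j.1 x, ap x j.2)} := by
  rw [symMul_dec hN (fun _ p => {am p.1 p.2}), Finset.sum_comm]
  simp [MAp, apply_ite (Multiset.map _)]

theorem symMul_row_MAm {I : Type} (i : I) (j : Fin N × Fin N) :
    symMul (fun (_ : I) c => {ap (dec N hN c).1 (dec N hN c).2})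
      (fun r c => MAm am (dec N hN r) c) i j = ∑ x, {(ap x j.2, am j.1 x)} := by
  rw [symMul_dec hN (fun _ p => {ap p.1 p.2})]
  simp [MAm, apply_ite (Multiset.map _)]

theorem smbOfSymMatrix_commute (l : ℕ) (i : Fin (msize N l)) (j : Fin (msize N (l + 2))) :
    (symMul ((smbOfSymMatrix hN am ap).Mm l) ((smbOfSymMatrix hN am ap).Mp (l + 1)) i j).map
        Prod.swap =
      symMul ((smbOfSymMatrix hN am ap).Mp l) ((smbOfSymMatrix hN am ap).Mm (l + 1)) i j := by
  cases l with
  | zero =>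
    refine (congrArg _ (symMul_row_MAp hN am ap i (dec N hN j))).trans
      (Eq.trans ?_ (symMul_row_MAm hN am ap i (dec N hN j)).symm)
    rw [← Multiset.coe_mapAddMonoidHom, map_sum]
    simp
  | succ l =>
    refine (congrArg _ (symMul_MAm_MAp hN am ap (dec N hN i) (dec N hN j))).trans
      (Eq.trans ?_ (symMul_MAp_MAm hN am ap (dec N hN i) (dec N hN j)).symm)
    simp

end SymMul

theorem mem_MAm {S : Type} {N : ℕ} {am : Fin N → Fin N → S} {r c : Fin N × Fin N} {s : S} :
    s ∈ MAm am r c ↔ r.2 = c.2 ∧ s = am c.1 r.1 := by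
  unfold MAm
  split_ifs <;> simp_all

theorem mem_MAp {T : Type} {N : ℕ} {ap : Fin N → Fin N → T} {r c : Fin N × Fin N} {t : T} :
    t ∈ MAp ap r c ↔ r.1 = c.1 ∧ t = ap r.2 c.2 := by
  unfold MAp
  split_ifs <;> simp_all

theorem nodup_MAm {S : Type} {N : ℕ} (am : Fin N → Fin N → S) (r c : Fin N × Fin N) :
    (MAm am r c).Nodup := by
  unfold MAm
  split_ifs <;> simp

theorem nodup_MAp {T : Type} {N : ℕ} (ap : Fin N → Fin N → T) (r c : Fin N × Fin N) :
    (MAp ap r c).Nodup := by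
  unfold MAp
  split_ifs <;> simp

theorem isSMB_smbOfSymMatrix {S T : Type} {N : ℕ} (hN : 0 < N)
    {am : Fin N → Fin N → S} {ap : Fin N → Fin N → T}
    (ham : Function.Injective fun p : Fin N × Fin N => am p.1 p.2)
    (hap : Function.Injective fun p : Fin N × Fin N => ap p.1 p.2) :
    IsSMB (smbOfSymMatrix hN am ap) where
  mpos
    | 0 => Nat.one_pos
    | _ + 1 => Nat.mul_pos hN hN
  row_m
    | 0, _ => ⟨(⟨0, Nat.mul_pos hN hN⟩ : Fin (N * N)), Multiset.singleton_ne_zero _⟩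
    | _ + 1, i => ⟨i, (if_pos rfl).trans_ne (Multiset.singleton_ne_zero _)⟩
  col_m
    | 0, _ => ⟨(0 : Fin 1), Multiset.singleton_ne_zero _⟩
    | _ + 1, j => ⟨j, (if_pos rfl).trans_ne (Multiset.singleton_ne_zero _)⟩
  row_p
    | 0, _ => ⟨(⟨0, Nat.mul_pos hN hN⟩ : Fin (N * N)), Multiset.singleton_ne_zero _⟩
    | _ + 1, i => ⟨i, (if_pos rfl).trans_ne (Multiset.singleton_ne_zero _)⟩
  col_p
    | 0, _ => ⟨(0 : Fin 1), Multiset.singleton_ne_zero _⟩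
    | _ + 1, j => ⟨j, (if_pos rfl).trans_ne (Multiset.singleton_ne_zero _)⟩
  nodup_m
    | 0, _, _ => Multiset.nodup_singleton _
    | _ + 1, _, _ => nodup_MAm _ _ _
  nodup_p
    | 0, _, _ => Multiset.nodup_singleton _
    | _ + 1, _, _ => nodup_MAp _ _ _
  res_m
    | 0, _, i, i', _, _, _ => Subsingleton.elim (α := Fin 1) i i'
    | _ + 1, _, _, _, _, h, h' => by
      obtain ⟨h₂, rfl⟩ := mem_MAm.1 h
      obtain ⟨h₂', e⟩ := mem_MAm.1 h'
      exact (dec_bijective hN).1 (Prod.ext (Prod.ext_iff.1 (@ham (_, _) (_, _) e)).2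
        (h₂.trans h₂'.symm))
  res_p
    | 0, _, i, i', _, _, _ => Subsingleton.elim (α := Fin 1) i i'
    | _ + 1, _, _, _, _, h, h' => by
      obtain ⟨h₁, rfl⟩ := mem_MAp.1 h
      obtain ⟨h₁', e⟩ := mem_MAp.1 h'
      exact (dec_bijective hN).1 (Prod.ext (h₁.trans h₁'.symm)
        (Prod.ext_iff.1 (@hap (_, _) (_, _) e)).1)
  commute := smbOfSymMatrix_commute hN am ap

theorem mem_prodFrom_succ {S : Type} {m : ℕ → ℕ}
    {M : ∀ l, Fin (m l) → Fin (m (l + 1)) → Multiset S} {n k : ℕ} {i : Fin (m n)}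
    {j : Fin (m (n + (k + 1)))} {w : List S} :
    w ∈ prodFrom M n (k + 1) i j ↔
      ∃ p, ∃ v ∈ prodFrom M n k i p, ∃ s ∈ M (n + k) p j, v ++ [s] = w := by
  simp [prodFrom, Multiset.mem_sum]

theorem mem_prodFrom_one {S : Type} {m : ℕ → ℕ}
    {M : ∀ l, Fin (m l) → Fin (m (l + 1)) → Multiset S} [Subsingleton (Fin (m 0))]
    {i : Fin (m 0)} {j : Fin (m (0 + 1))} {w : List S} :
    w ∈ prodFrom M 0 1 i j ↔ ∃ s ∈ M 0 i j, [s] = w := by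
  rw [mem_prodFrom_succ]
  constructor
  · rintro ⟨p, v, hv, s, hs, rfl⟩
    obtain rfl := Subsingleton.elim i p
    simp only [prodFrom, if_true, Multiset.mem_singleton] at hv
    exact ⟨s, hs, by simp [hv]⟩
  · rintro ⟨s, hs, rfl⟩
    exact ⟨i, [], by simp [prodFrom], s, hs, rfl⟩

/-- The label words of the walks with `k + 1` edges from `x` to `y` in the complete directed
graph on `Fin N` whose edge from `u` to `v` is labelled `a u v`. -/
def walkWords {S : Type} {N : ℕ} (a : Fin N → Fin N → S) : ℕ → Fin N → Fin N → Set (List S)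
  | 0, x, y => {[a x y]}
  | k + 1, x, y => {w | ∃ z, ∃ v ∈ walkWords a k x z, v ++ [a z y] = w}

section WalkWords

variable {S : Type} {N : ℕ} {a : Fin N → Fin N → S}

theorem mem_walkWords_succ_iff_cons {k : ℕ} {x y : Fin N} {w : List S} :
    w ∈ walkWords a (k + 1) x y ↔ ∃ z, ∃ v ∈ walkWords a k z y, a x z :: v = w := by
  induction k generalizing y w with
  | zero => simp [walkWords]
  | succ k ih =>
    rw [walkWords, Set.mem_ofPred_eq]
    simp only [ih]
    constructor
    · rintro ⟨z, _, ⟨u, v, hv, rfl⟩, rfl⟩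
      exact ⟨u, v ++ [a z y], ⟨z, v, hv, rfl⟩, rfl⟩
    · rintro ⟨u, _, ⟨z, v, hv, rfl⟩, rfl⟩
      exact ⟨z, _, ⟨u, v, hv, rfl⟩, rfl⟩

variable (hN : 0 < N)

theorem mem_prodFrom_Mp_iff {k : ℕ} {i : Fin 1} {j : Fin (N * N)} {w : List S} :
    w ∈ prodFrom (smbOfSymMatrix hN a a).Mp 0 (k + 1) i j ↔
      w ∈ walkWords a k (dec N hN j).1 (dec N hN j).2 := by
  induction k generalizing j w with
  | zero =>
    have : Subsingleton (Fin ((smbOfSymMatrix hN a a).m 0)) :=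
      inferInstanceAs (Subsingleton (Fin 1))
    refine mem_prodFrom_one.trans ?_
    simp [smbOfSymMatrix, walkWords, eq_comm]
  | succ k ih =>
    refine mem_prodFrom_succ.trans ⟨?_, ?_⟩
    · rintro ⟨p, v, hv, s, hs, rfl⟩
      obtain ⟨h, rfl⟩ := mem_MAp.1 hs
      exact ⟨_, v, h ▸ ih.1 hv, rfl⟩
    · rintro ⟨z, v, hv, rfl⟩
      obtain ⟨p, hp⟩ := (dec_bijective hN).2 ((dec N hN j).1, z)
      refine ⟨p, v, ih.2 (by rwa [hp]), _,
        mem_MAp.2 ⟨(Prod.ext_iff.1 hp).1, rfl⟩, ?_⟩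
      exact congrArg (fun q => v ++ [a q.2 (dec N hN j).2]) hp

theorem mem_prodFrom_Mm_iff {k : ℕ} {i : Fin 1} {j : Fin (N * N)} {w : List S} :
    w ∈ prodFrom (smbOfSymMatrix hN a a).Mm 0 (k + 1) i j ↔
      w.reverse ∈ walkWords a k (dec N hN j).1 (dec N hN j).2 := by
  induction k generalizing j w with
  | zero =>
    have : Subsingleton (Fin ((smbOfSymMatrix hN a a).m 0)) :=
      inferInstanceAs (Subsingleton (Fin 1))
    refine mem_prodFrom_one.trans ?_
    simp [smbOfSymMatrix, walkWords, List.reverse_eq_iff, eq_comm (a := w)]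
  | succ k ih =>
    rw [mem_walkWords_succ_iff_cons]
    refine mem_prodFrom_succ.trans ⟨?_, ?_⟩
    · rintro ⟨p, v, hv, s, hs, rfl⟩
      obtain ⟨h, rfl⟩ := mem_MAm.1 hs
      exact ⟨_, v.reverse, h ▸ ih.1 hv, by simp⟩
    · rintro ⟨z, v, hv, hw⟩
      obtain ⟨p, hp⟩ := (dec_bijective hN).2 (z, (dec N hN j).2)
      refine ⟨p, v.reverse, ih.2 (by rwa [hp, List.reverse_reverse]), _,
        mem_MAm.2 ⟨(Prod.ext_iff.1 hp).2, rfl⟩, ?_⟩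
      rw [← List.reverse_reverse w, ← hw, List.reverse_cons]
      exact congrArg (fun q => v.reverse ++ [a (dec N hN j).1 q.1]) hp

end WalkWords

theorem fpcc_smbOfSymMatrix {S : Type} {N : ℕ} (hN : 0 < N) (a : Fin N → Fin N → S) :
    (smbOfSymMatrix hN a a).FPCC := by
  refine ⟨rfl, fun l hl i j w => ?_⟩
  obtain _ | k := l
  · exact absurd hl (by simp)
  · exact (mem_prodFrom_Mm_iff hN).trans (mem_prodFrom_Mp_iff hN).symm

/-- if the symbols `α_{ij}` are pairwise distinct, the pair
`(M⁻_{l,l+1}, M⁺_{l,l+1})_{l ≥ 0}` above is a standard symbolic matrix bisystem over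
`Σ⁻, Σ⁺`; moreover, identifying `α⁻_{ij}` with `α⁺_{ij}` it satisfies FPCC. -/
theorem stmt_16 {N : ℕ} (hN : 0 < N) :
    (∀ (S T : Type) (am : Fin N → Fin N → S) (ap : Fin N → Fin N → T),
      Function.Injective (fun p : Fin N × Fin N => am p.1 p.2) →
      Function.Injective (fun p : Fin N × Fin N => ap p.1 p.2) →
      IsSMB (smbOfSymMatrix hN am ap) ∧ (smbOfSymMatrix hN am ap).m 0 = 1) ∧
    (∀ (S : Type) (a : Fin N → Fin N → S),
      Function.Injective (fun p : Fin N × Fin N => a p.1 p.2) →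
      (smbOfSymMatrix hN a a).FPCC) := by
  exact ⟨fun _ _ _ _ ham hap => ⟨isSMB_smbOfSymMatrix hN ham hap, rfl⟩,
    fun _ a _ => fpcc_smbOfSymMatrix hN a⟩
end
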